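/- arXiv:1705.02418 — 4 statements merged into one kernel-verified Lean document; each statement's English description precedes it below -/
import Mathlib

section
/- For any graph G on vertex set {0,1,...,n} and any two reduction trees R1 and R2 of G, the multiset of left-degree sequences of the graphs labeling the leaves of R1 equals the multiset of left-degree sequences of the graphs labeling the leaves of R2. In particular, the multiset LD(G) of left-degree sequences of leaves of a reduction tree of G depends only on G and not on the choice of reduction tree. -/
open Multiset

/-- A graph on `[0,n]` is a finite multiset of directed edges `(i,j)` with `i < j`. -/
def ValidGraph (n : ℕ) (G : Multiset (Fin (n + 1) × Fin (n + 1))) : Prop :=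
  ∀ e ∈ G, e.1 < e.2

/-- A graph is irreducible if no reduction can be performed on it, i.e. there is no vertex
`j` having both an incoming edge `(i,j)` and an outgoing edge `(j,k)`. -/
def IrreducibleGraph (n : ℕ) (G : Multiset (Fin (n + 1) × Fin (n + 1))) : Prop :=
  ¬∃ i j k : Fin (n + 1), i < j ∧ j < k ∧ (i, j) ∈ G ∧ (j, k) ∈ G

/-- A reduction tree of a graph `G` on `[0,n]`: a finite rooted ternary tree whose root is
labeled `G`, in which the three children of an internal node labeled `H` are labeled by
the three graphs `H₁ = H - (j,k) + (i,k)`, `H₂ = H - (i,j) + (i,k)`,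
`H₃ = H - (i,j) - (j,k) + (i,k)` obtained by performing a reduction on edges
`(i,j), (j,k) ∈ H` with `i < j < k`, and whose leaves are labeled by irreducible graphs. -/
inductive ReductionTree (n : ℕ) : Multiset (Fin (n + 1) × Fin (n + 1)) → Type where
  | leaf (G : Multiset (Fin (n + 1) × Fin (n + 1))) (h : IrreducibleGraph n G) : ReductionTree n G
  | node (G : Multiset (Fin (n + 1) × Fin (n + 1))) (i j k : Fin (n + 1))
      (hij : i < j) (hjk : j < k) (h1 : (i, j) ∈ G) (h2 : (j, k) ∈ G)
      (t1 : ReductionTree n ((i, k) ::ₘ G.erase (j, k)))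
      (t2 : ReductionTree n ((i, k) ::ₘ G.erase (i, j)))
      (t3 : ReductionTree n ((i, k) ::ₘ (G.erase (i, j)).erase (j, k))) :
      ReductionTree n G

/-- The multiset of (labels of) leaves of a reduction tree. -/
def ReductionTree.leaves {n : ℕ} : {G : Multiset (Fin (n + 1) × Fin (n + 1))} →
    ReductionTree n G → Multiset (Multiset (Fin (n + 1) × Fin (n + 1)))
  | _, .leaf G _ => {G}
  | _, .node _ _ _ _ _ _ _ _ t1 t2 t3 => t1.leaves + t2.leaves + t3.leaves

/-- The left-degree sequence `(indeg_L 1, …, indeg_L n)` of a graph `L` on `[0,n]`,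
where `indeg_L i` is the number of edges of `L` ending at the vertex `i`, counted with
multiplicity. -/
def leftDegSeq (n : ℕ) (L : Multiset (Fin (n + 1) × Fin (n + 1))) : Fin n → ℕ :=
  fun i => (L.filter fun e => (e.2 : ℕ) = (i : ℕ) + 1).card

/-- The exponent of the monomial `z_{i+1} ⋯ z_j` attached to an edge `(i,j)`. -/
noncomputable def edgeExponent (i j : ℕ) : ℕ →₀ ℕ := ∑ l ∈ Finset.Ioc i j, Finsupp.single l 1

theorem edgeExponent_apply (i j l : ℕ) :
    edgeExponent i j l = if i < l ∧ l ≤ j then 1 else 0 := by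
  simp [edgeExponent, Finsupp.finsetSum_apply, Finsupp.single_apply]

theorem edgeExponent_add {i j k : ℕ} (hij : i < j) (hjk : j < k) :
    edgeExponent i j + edgeExponent j k = edgeExponent i k := by
  ext l
  simp only [Finsupp.add_apply, edgeExponent_apply]
  split_ifs <;> omega

theorem edgeExponent_ne_zero {i j : ℕ} (hij : i < j) : edgeExponent i j ≠ 0 := by
  intro h
  have := DFunLike.congr_fun h j
  simp [edgeExponent_apply, hij] at this

/-- The geometric series `m + m² + m³ + ⋯` in the monomial `m` with exponent `c ≠ 0`. -/
noncomputable def geomSeries (c : ℕ →₀ ℕ) : MvPowerSeries ℕ ℚ :=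
  MvPowerSeries.monomial c 1 * (1 - MvPowerSeries.monomial c 1)⁻¹

theorem constantCoeff_one_sub_monomial {c : ℕ →₀ ℕ} (hc : c ≠ 0) :
    MvPowerSeries.constantCoeff (1 - MvPowerSeries.monomial c (1 : ℚ)) = 1 := by
  classical
  rw [← MvPowerSeries.coeff_zero_eq_constantCoeff_apply, map_sub, MvPowerSeries.coeff_monomial,
    if_neg hc.symm]
  simp

theorem one_sub_monomial_mul_inv {c : ℕ →₀ ℕ} (hc : c ≠ 0) :
    (1 - MvPowerSeries.monomial c (1 : ℚ)) * (1 - MvPowerSeries.monomial c 1)⁻¹ = 1 :=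
  MvPowerSeries.mul_inv_cancel _ (by rw [constantCoeff_one_sub_monomial hc]; exact one_ne_zero)

theorem geomSeries_eq {c : ℕ →₀ ℕ} (hc : c ≠ 0) :
    geomSeries c = MvPowerSeries.monomial c 1 + MvPowerSeries.monomial c 1 * geomSeries c := by
  have h := one_sub_monomial_mul_inv hc
  unfold geomSeries
  linear_combination (MvPowerSeries.monomial c (1 : ℚ)) * h

theorem eq_geomSeries {c : ℕ →₀ ℕ} (hc : c ≠ 0) {f : MvPowerSeries ℕ ℚ}
    (hf : f = MvPowerSeries.monomial c 1 + MvPowerSeries.monomial c 1 * f) :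
    f = geomSeries c := by
  have h := one_sub_monomial_mul_inv hc
  unfold geomSeries
  linear_combination (1 - MvPowerSeries.monomial c (1 : ℚ))⁻¹ * hf - f * h

theorem geomSeries_mul_geomSeries {c d : ℕ →₀ ℕ} (hc : c ≠ 0) (hd : d ≠ 0) :
    geomSeries c * geomSeries d =
      geomSeries (c + d) * (geomSeries c + geomSeries d + 1) := by
  have hcd : c + d ≠ 0 := by simp [hc]
  have h1 := geomSeries_eq hc
  have h2 := geomSeries_eq hd
  have h3 := one_sub_monomial_mul_inv hcd
  have hm : MvPowerSeries.monomial (c + d) (1 : ℚ) =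
      MvPowerSeries.monomial c 1 * MvPowerSeries.monomial d 1 := by
    rw [MvPowerSeries.monomial_mul_monomial, one_mul]
  rw [show geomSeries (c + d) = MvPowerSeries.monomial (c + d) 1 *
    (1 - MvPowerSeries.monomial (c + d) 1)⁻¹ from rfl]
  rw [hm] at h3 ⊢
  generalize geomSeries c = A at *
  generalize geomSeries d = B at *
  generalize MvPowerSeries.monomial c (1 : ℚ) = x at *
  generalize MvPowerSeries.monomial d (1 : ℚ) = y at *
  generalize (1 - x * y)⁻¹ = u at *
  have key : (1 - x * y) * (A * B) = x * y * (A + B + 1) := by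
    linear_combination B * h1 + x * (1 + A) * h2
  linear_combination u * key - A * B * h3

/-- The componentwise positive part of the net flow `j ↦ c j - c (j + 1)`. -/
noncomputable def netInflow (c : ℕ →₀ ℕ) : ℕ →₀ ℕ :=
  Finsupp.onFinset c.support (fun j => c j - c (j + 1)) (by
    intro j h
    rw [Finsupp.mem_support_iff]
    omega)

@[simp]
theorem netInflow_apply (c : ℕ →₀ ℕ) (j : ℕ) : netInflow c j = c j - c (j + 1) := rfl

theorem apply_le_sum_netInflow (c : ℕ →₀ ℕ) (j m : ℕ) :
    c j ≤ ∑ k ∈ Finset.Ico j (j + m), netInflow c k + c (j + m) := by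
  induction m with
  | zero => simp
  | succ m ih =>
    rw [← add_assoc, Finset.sum_Ico_succ_top (by omega), netInflow_apply]
    omega

theorem le_sum_netInflow (c : ℕ →₀ ℕ) :
    c ≤ (netInflow c).sum fun k m => m • edgeExponent 0 k + Finsupp.single 0 m := by
  intro j
  obtain ⟨N, hN⟩ := c.support.exists_nat_subset_range
  have h0 : c (j + N) = 0 := by
    by_contra h
    have := Finset.mem_range.1 (hN (Finsupp.mem_support_iff.2 h))
    omega
  refine (apply_le_sum_netInflow c j N).trans ?_
  rw [h0, add_zero, Finsupp.sum, Finsupp.finsetSum_apply]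
  rw [← Finset.sum_filter_ne_zero]
  refine (Finset.sum_le_sum fun k hk => ?_).trans
    (Finset.sum_le_sum_of_subset (fun k hk => ?_))
  · simp only [Finset.mem_filter, Finset.mem_Ico] at hk
    simp only [Finsupp.add_apply, Finsupp.smul_apply, edgeExponent_apply, Finsupp.single_apply,
      smul_eq_mul]
    split_ifs <;> omega
  · exact Finsupp.mem_support_iff.2 (Finset.mem_filter.1 hk).2

theorem finite_netInflow_eq (a : ℕ →₀ ℕ) : {c | netInflow c = a}.Finite := by
  refine (Set.finite_Iic (a.sum fun k m => m • edgeExponent 0 k + Finsupp.single 0 m)).subset ?_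
  rintro c rfl
  exact le_sum_netInflow c

/-- Push a power series forward along `netInflow`. -/
noncomputable def inflowSeries : MvPowerSeries ℕ ℚ →+ MvPowerSeries ℕ ℚ where
  toFun f := fun a => ∑ c ∈ (finite_netInflow_eq a).toFinset, MvPowerSeries.coeff c f
  map_zero' := by
    funext a
    exact Finset.sum_eq_zero fun c _ => map_zero _
  map_add' f g := by
    funext a
    exact (Finset.sum_congr rfl fun c _ => _root_.map_add _ f g).trans Finset.sum_add_distrib

theorem coeff_inflowSeries (f : MvPowerSeries ℕ ℚ) (a : ℕ →₀ ℕ) :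
    MvPowerSeries.coeff a (inflowSeries f) =
      ∑ c ∈ (finite_netInflow_eq a).toFinset, MvPowerSeries.coeff c f := rfl

theorem inflowSeries_monomial (c : ℕ →₀ ℕ) :
    inflowSeries (MvPowerSeries.monomial c 1) = MvPowerSeries.monomial (netInflow c) 1 := by
  classical
  ext a
  simp [coeff_inflowSeries, MvPowerSeries.coeff_monomial, eq_comm]

/-- The flows whose net inflow is nonnegative on `S` and nonpositive off `S`. -/
def sinkCone (S : Set ℕ) : Set (ℕ →₀ ℕ) :=
  {c | ∀ j, (j ∈ S → c (j + 1) ≤ c j) ∧ (j ∉ S → c j ≤ c (j + 1))}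

theorem add_mem_sinkCone {S : Set ℕ} {c d : ℕ →₀ ℕ} (hc : c ∈ sinkCone S) (hd : d ∈ sinkCone S) :
    c + d ∈ sinkCone S := fun j =>
  ⟨fun h => add_le_add ((hc j).1 h) ((hd j).1 h), fun h => add_le_add ((hc j).2 h) ((hd j).2 h)⟩

theorem netInflow_add {S : Set ℕ} {c d : ℕ →₀ ℕ} (hc : c ∈ sinkCone S) (hd : d ∈ sinkCone S) :
    netInflow (c + d) = netInflow c + netInflow d := by
  ext j
  simp only [netInflow_apply, Finsupp.add_apply]
  by_cases h : j ∈ S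
  · have := (hc j).1 h
    have := (hd j).1 h
    omega
  · have := (hc j).2 h
    have := (hd j).2 h
    omega

theorem edgeExponent_mem_sinkCone {S : Set ℕ} {i j : ℕ} (hi : i ∉ S) (hj : j ∈ S) :
    edgeExponent i j ∈ sinkCone S := by
  intro l
  simp only [edgeExponent_apply]
  constructor
  · intro hl
    have : l ≠ i := by rintro rfl; exact hi hl
    split_ifs <;> omega
  · intro hl
    have : l ≠ j := by rintro rfl; exact hl hj
    split_ifs <;> omega

theorem netInflow_edgeExponent {i j : ℕ} (hij : i < j) :
    netInflow (edgeExponent i j) = Finsupp.single j 1 := by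
  ext l
  simp only [netInflow_apply, edgeExponent_apply, Finsupp.single_apply]
  split_ifs <;> omega

/-- The series all of whose exponents lie in `C`. -/
def SupportedIn (C : Set (ℕ →₀ ℕ)) (f : MvPowerSeries ℕ ℚ) : Prop :=
  ∀ c, MvPowerSeries.coeff c f ≠ 0 → c ∈ C

theorem supportedIn_mul {S : Set ℕ} {f g : MvPowerSeries ℕ ℚ} (hf : SupportedIn (sinkCone S) f)
    (hg : SupportedIn (sinkCone S) g) : SupportedIn (sinkCone S) (f * g) := by
  classical
  intro c hc
  rw [MvPowerSeries.coeff_mul] at hc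
  obtain ⟨p, hp, hne⟩ := Finset.exists_ne_zero_of_sum_ne_zero hc
  rw [← Finset.HasAntidiagonal.mem_antidiagonal.1 hp]
  exact add_mem_sinkCone (hf _ (left_ne_zero_of_mul hne)) (hg _ (right_ne_zero_of_mul hne))

theorem supportedIn_monomial {C : Set (ℕ →₀ ℕ)} {c : ℕ →₀ ℕ} (hc : c ∈ C) :
    SupportedIn C (MvPowerSeries.monomial c 1) := by
  classical
  intro d hd
  rw [MvPowerSeries.coeff_monomial] at hd
  by_cases h : d = c
  · exact h ▸ hc
  · simp [h] at hd

theorem supportedIn_geomSeries {S : Set ℕ} {c : ℕ →₀ ℕ} (hc0 : c ≠ 0) (hc : c ∈ sinkCone S) :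
    SupportedIn (sinkCone S) (geomSeries c) := by
  classical
  intro d
  induction d using WellFoundedLT.induction with
  | ind d ih =>
    intro hd
    rw [geomSeries_eq hc0, _root_.map_add, MvPowerSeries.coeff_monomial,
      MvPowerSeries.coeff_monomial_mul] at hd
    by_cases h : d = c
    · exact h ▸ hc
    · rw [if_neg h, zero_add] at hd
      split_ifs at hd with hle
      · have hlt : d - c < d := by
          refine lt_of_le_of_ne tsub_le_self fun heq => hc0 ?_
          have := tsub_add_cancel_of_le hle
          rw [heq] at this
          simpa using this
        have := add_mem_sinkCone (ih _ hlt (right_ne_zero_of_mul hd)) hc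
        rwa [tsub_add_cancel_of_le hle] at this
      · exact absurd rfl hd

theorem inflowSeries_mul {S : Set ℕ} {f g : MvPowerSeries ℕ ℚ} (hf : SupportedIn (sinkCone S) f)
    (hg : SupportedIn (sinkCone S) g) :
    inflowSeries (f * g) = inflowSeries f * inflowSeries g := by
  classical
  ext a
  simp only [MvPowerSeries.coeff_mul, coeff_inflowSeries, Finset.sum_mul_sum,
    ← Finset.sum_product', Finset.sum_sigma']
  refine Finset.sum_bij_ne_zero
    (fun x _ _ => ⟨(netInflow x.2.1, netInflow x.2.2), x.2⟩) ?_ ?_ ?_ ?_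
  · rintro ⟨c, p⟩ hx hne
    simp only [Finset.mem_sigma, Set.Finite.mem_toFinset, Set.mem_ofPred_eq,
      Finset.HasAntidiagonal.mem_antidiagonal, Finset.mem_product] at hx ⊢
    refine ⟨?_, trivial, trivial⟩
    rw [← netInflow_add (hf _ (left_ne_zero_of_mul hne)) (hg _ (right_ne_zero_of_mul hne)),
      hx.2, hx.1]
  · rintro ⟨c, p⟩ hx _ ⟨d, q⟩ hy _ h
    simp only [Finset.mem_sigma, Finset.HasAntidiagonal.mem_antidiagonal] at hx hy
    obtain rfl : p = q := by
      have := (Sigma.mk.inj_iff.1 h).2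
      exact eq_of_heq this
    rw [← hx.2, ← hy.2]
  · rintro ⟨⟨a₁, a₂⟩, p⟩ hx hne
    simp only [Finset.mem_sigma, Set.Finite.mem_toFinset, Set.mem_ofPred_eq,
      Finset.HasAntidiagonal.mem_antidiagonal, Finset.mem_product] at hx
    obtain ⟨h, rfl, rfl⟩ := hx
    refine ⟨⟨p.1 + p.2, p⟩, ?_, hne, rfl⟩
    simp only [Finset.mem_sigma, Set.Finite.mem_toFinset, Set.mem_ofPred_eq,
      Finset.HasAntidiagonal.mem_antidiagonal, and_true]
    rw [netInflow_add (hf _ (left_ne_zero_of_mul hne)) (hg _ (right_ne_zero_of_mul hne)), h]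
  · intros
    rfl

theorem inflowSeries_geomSeries_edgeExponent {S : Set ℕ} {i j : ℕ} (hij : i < j) (hi : i ∉ S)
    (hj : j ∈ S) :
    inflowSeries (geomSeries (edgeExponent i j)) = geomSeries (Finsupp.single j 1) := by
  have hc := edgeExponent_mem_sinkCone hi hj
  have h0 := edgeExponent_ne_zero hij
  refine eq_geomSeries (by simp) ?_
  conv_lhs => rw [geomSeries_eq h0]
  rw [_root_.map_add, inflowSeries_mul (supportedIn_monomial hc) (supportedIn_geomSeries h0 hc),
    inflowSeries_monomial, netInflow_edgeExponent hij]

/-- The product over the edges of `G` of the geometric series attached to them: the generating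
function of the flows on `G` that are positive on every edge. -/
noncomputable def flowSeries {n : ℕ} (G : Multiset (Fin (n + 1) × Fin (n + 1))) :
    MvPowerSeries ℕ ℚ :=
  (G.map fun e => geomSeries (edgeExponent e.1 e.2)).prod

/-- The multiset of the endpoints of the edges of `G`. -/
def targets {n : ℕ} (G : Multiset (Fin (n + 1) × Fin (n + 1))) : Multiset ℕ :=
  G.map fun e => (e.2 : ℕ)

/-- The product over `j ∈ D` of the geometric series in the variable `j`. -/
noncomputable def geomMonomial (D : Multiset ℕ) : MvPowerSeries ℕ ℚ :=
  (D.map fun j => geomSeries (Finsupp.single j 1)).prod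

theorem inflowSeries_flowSeries_of_sinks {n : ℕ} {S : Set ℕ}
    {G : Multiset (Fin (n + 1) × Fin (n + 1))}
    (hG : ∀ e ∈ G, e.1 < e.2 ∧ (e.1 : ℕ) ∉ S ∧ (e.2 : ℕ) ∈ S) :
    SupportedIn (sinkCone S) (flowSeries G) ∧
      inflowSeries (flowSeries G) = geomMonomial (targets G) := by
  induction G using Multiset.induction with
  | empty =>
    have h0 : (0 : ℕ →₀ ℕ) ∈ sinkCone S := fun j => by simp
    have h1 : netInflow 0 = 0 := by ext; simp
    have hm : (1 : MvPowerSeries ℕ ℚ) = MvPowerSeries.monomial 0 1 := rfl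
    simp only [flowSeries, targets, geomMonomial, Multiset.map_zero, Multiset.prod_zero]
    rw [hm]
    exact ⟨supportedIn_monomial h0, by rw [inflowSeries_monomial, h1]⟩
  | cons e G ih =>
    obtain ⟨hs, hp⟩ := ih fun e' he' => hG e' (Multiset.mem_cons_of_mem he')
    obtain ⟨hlt, h1, h2⟩ := hG e (Multiset.mem_cons_self _ _)
    have he := supportedIn_geomSeries (edgeExponent_ne_zero (Fin.lt_def.1 hlt))
      (edgeExponent_mem_sinkCone h1 h2)
    have hcons : flowSeries (e ::ₘ G) = geomSeries (edgeExponent e.1 e.2) * flowSeries G := by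
      simp [flowSeries]
    rw [hcons]
    refine ⟨supportedIn_mul he hs, ?_⟩
    rw [inflowSeries_mul he hs, hp,
      inflowSeries_geomSeries_edgeExponent (Fin.lt_def.1 hlt) h1 h2]
    simp [geomMonomial, targets]

theorem inflowSeries_flowSeries_of_irreducible {n : ℕ} {G : Multiset (Fin (n + 1) × Fin (n + 1))}
    (hG : ValidGraph n G) (hirr : IrreducibleGraph n G) :
    inflowSeries (flowSeries G) = geomMonomial (targets G) := by
  refine (inflowSeries_flowSeries_of_sinks (S := {j | j ∈ targets G}) fun e he => ?_).2
  refine ⟨hG e he, ?_, Multiset.mem_map_of_mem (fun e => (e.2 : ℕ)) he⟩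
  rintro h
  obtain ⟨e', he', heq⟩ := Multiset.mem_map.1 h
  have heq' : e'.2 = e.1 := Fin.ext heq
  exact hirr ⟨e'.1, e.1, e.2, heq' ▸ hG e' he', hG e he, by rw [← heq']; exact he', he⟩

theorem flowSeries_reduction {n : ℕ} {G : Multiset (Fin (n + 1) × Fin (n + 1))}
    {i j k : Fin (n + 1)} (hij : i < j) (hjk : j < k) (h1 : (i, j) ∈ G) (h2 : (j, k) ∈ G) :
    flowSeries G = flowSeries ((i, k) ::ₘ G.erase (j, k)) +
      flowSeries ((i, k) ::ₘ G.erase (i, j)) +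
      flowSeries ((i, k) ::ₘ (G.erase (i, j)).erase (j, k)) := by
  have hne : (j, k) ≠ (i, j) := fun h => hij.ne' (Prod.ext_iff.1 h).1
  have h2' : (j, k) ∈ G.erase (i, j) := (Multiset.mem_erase_of_ne hne).2 h2
  obtain ⟨H, hH⟩ := Multiset.exists_cons_of_mem h2'
  obtain rfl : G = (i, j) ::ₘ (j, k) ::ₘ H := by rw [← hH, Multiset.cons_erase h1]
  have e1 : ((i, j) ::ₘ (j, k) ::ₘ H).erase (j, k) = (i, j) ::ₘ H := by
    rw [Multiset.cons_swap, Multiset.erase_cons_head]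
  rw [e1, Multiset.erase_cons_head, Multiset.erase_cons_head]
  have key := geomSeries_mul_geomSeries (edgeExponent_ne_zero (Fin.lt_def.1 hij))
    (edgeExponent_ne_zero (Fin.lt_def.1 hjk))
  rw [edgeExponent_add (Fin.lt_def.1 hij) (Fin.lt_def.1 hjk)] at key
  simp only [flowSeries, Multiset.map_cons, Multiset.prod_cons]
  linear_combination (H.map fun e => geomSeries (edgeExponent e.1 e.2)).prod * key

theorem inflowSeries_flowSeries {n : ℕ} {G : Multiset (Fin (n + 1) × Fin (n + 1))}
    (hG : ValidGraph n G) (R : ReductionTree n G) :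
    inflowSeries (flowSeries G) = ((R.leaves.map targets).map geomMonomial).sum := by
  induction R with
  | leaf G h => simp [ReductionTree.leaves, inflowSeries_flowSeries_of_irreducible hG h]
  | node G i j k hij hjk h1 h2 t1 t2 t3 ih1 ih2 ih3 =>
    have hsub {H : Multiset (Fin (n + 1) × Fin (n + 1))} (hH : H ≤ G) :
        ValidGraph n ((i, k) ::ₘ H) := fun e he =>
      (Multiset.mem_cons.1 he).elim (fun h => h ▸ hij.trans hjk)
        fun h => hG e (Multiset.mem_of_le hH h)
    rw [flowSeries_reduction hij hjk h1 h2, _root_.map_add, _root_.map_add,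
      ih1 (hsub (Multiset.erase_le _ _)), ih2 (hsub (Multiset.erase_le _ _)),
      ih3 (hsub ((Multiset.erase_le _ _).trans (Multiset.erase_le _ _)))]
    simp [ReductionTree.leaves]

theorem geomMonomial_eq_monomial_mul (D : Multiset ℕ) :
    ∃ u : MvPowerSeries ℕ ℚ, MvPowerSeries.constantCoeff u = 1 ∧
      geomMonomial D = MvPowerSeries.monomial (Multiset.toFinsupp D) 1 * u := by
  induction D using Multiset.induction with
  | empty => exact ⟨1, by simp, by simp [geomMonomial]⟩
  | cons j D ih =>
    obtain ⟨u, hu, hD⟩ := ih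
    have hj : (Finsupp.single j 1 : ℕ →₀ ℕ) ≠ 0 := by simp
    refine ⟨(1 - MvPowerSeries.monomial (Finsupp.single j 1) 1)⁻¹ * u, ?_, ?_⟩
    · rw [map_mul, MvPowerSeries.constantCoeff_inv, constantCoeff_one_sub_monomial hj, hu]
      norm_num
    · have hm : MvPowerSeries.monomial (Multiset.toFinsupp (j ::ₘ D)) (1 : ℚ) =
          MvPowerSeries.monomial (Finsupp.single j 1) 1 *
            MvPowerSeries.monomial (Multiset.toFinsupp D) 1 := by
        rw [MvPowerSeries.monomial_mul_monomial, one_mul, ← Multiset.singleton_add, _root_.map_add,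
          Multiset.toFinsupp_singleton]
      rw [hm, geomMonomial, Multiset.map_cons, Multiset.prod_cons, ← geomMonomial, hD, geomSeries]
      ring

theorem coeff_geomMonomial_self (D : Multiset ℕ) :
    MvPowerSeries.coeff (Multiset.toFinsupp D) (geomMonomial D) = 1 := by
  classical
  obtain ⟨u, hu, hD⟩ := geomMonomial_eq_monomial_mul D
  rw [hD, MvPowerSeries.coeff_monomial_mul, if_pos le_rfl, tsub_self,
    MvPowerSeries.coeff_zero_eq_constantCoeff_apply, hu, one_mul]

theorem coeff_geomMonomial_of_not_le {D E : Multiset ℕ} (h : ¬D ≤ E) :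
    MvPowerSeries.coeff (Multiset.toFinsupp E) (geomMonomial D) = 0 := by
  classical
  obtain ⟨u, -, hD⟩ := geomMonomial_eq_monomial_mul D
  rw [hD, MvPowerSeries.coeff_monomial_mul, if_neg]
  rwa [← Finsupp.orderIsoMultiset.le_iff_le, Finsupp.coe_orderIsoMultiset,
    Multiset.toFinsupp_toMultiset, Multiset.toFinsupp_toMultiset]

theorem eq_of_sum_geomMonomial_eq {M N : Multiset (Multiset ℕ)}
    (h : (M.map geomMonomial).sum = (N.map geomMonomial).sum) : M = N := by
  classical
  have key (E : Multiset ℕ) (P : Multiset (Multiset ℕ)) (hP : P ⊆ M + N) :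
      MvPowerSeries.coeff (Multiset.toFinsupp E) (P.map geomMonomial).sum =
        ∑ D ∈ (M + N).toFinset,
          (P.count D : ℚ) * MvPowerSeries.coeff (Multiset.toFinsupp E) (geomMonomial D) := by
    rw [map_multiset_sum, Multiset.map_map, Finset.sum_multiset_map_count]
    simp only [Function.comp, nsmul_eq_mul]
    refine Finset.sum_subset (fun D hD => ?_) (fun D _ hD => ?_)
    · exact Multiset.mem_toFinset.2 (hP (Multiset.mem_toFinset.1 hD))
    · rw [Multiset.count_eq_zero_of_notMem (fun h => hD (Multiset.mem_toFinset.2 h))]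
      simp
  ext E
  induction E using WellFoundedLT.induction with
  | ind E ih =>
    have hE := congrArg (MvPowerSeries.coeff (Multiset.toFinsupp E)) h
    rw [key E M (Multiset.subset_of_le (Multiset.le_add_right _ _)),
      key E N (Multiset.subset_of_le (Multiset.le_add_left _ _)), ← sub_eq_zero,
      ← Finset.sum_sub_distrib] at hE
    rw [Finset.sum_eq_single E] at hE
    · rw [coeff_geomMonomial_self, mul_one, mul_one, sub_eq_zero] at hE
      exact_mod_cast hE
    · intro D _ hne
      by_cases hle : D ≤ E
      · rw [ih D (lt_of_le_of_ne hle hne), sub_self]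
      · rw [coeff_geomMonomial_of_not_le hle, mul_zero, mul_zero, sub_self]
    · intro hmem
      rw [Multiset.mem_toFinset, Multiset.mem_add, not_or] at hmem
      simp [Multiset.count_eq_zero_of_notMem hmem.1, Multiset.count_eq_zero_of_notMem hmem.2]

theorem leftDegSeq_eq_count_targets (n : ℕ) (L : Multiset (Fin (n + 1) × Fin (n + 1))) :
    leftDegSeq n L = fun i : Fin n => (targets L).count ((i : ℕ) + 1) := by
  funext i
  simp [leftDegSeq, targets, Multiset.count_map, eq_comm]

/-- Theorem A, independence of the reduction tree.  For any graph `G` on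
`[0,n]` and any two reduction trees of `G`, the multisets of left-degree sequences of the
leaves coincide; in particular `LD(G)` depends only on `G`. -/
theorem leftDegree_multiset_independent (n : ℕ)
    (G : Multiset (Fin (n + 1) × Fin (n + 1))) (hG : ValidGraph n G)
    (R1 R2 : ReductionTree n G) :
    R1.leaves.map (leftDegSeq n) = R2.leaves.map (leftDegSeq n) := by
  have key : R1.leaves.map targets = R2.leaves.map targets :=
    eq_of_sum_geomMonomial_eq
      ((inflowSeries_flowSeries hG R1).symm.trans (inflowSeries_flowSeries hG R2))
  have h := congrArg
    (Multiset.map fun (D : Multiset ℕ) (i : Fin n) => D.count ((i : ℕ) + 1)) key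
  simp only [Multiset.map_map, Function.comp_def, ← leftDegSeq_eq_count_targets] at h
  exact h
end

section
/- Let G0 be a graph on [0,n] containing edges r1 = (i,j) and r2 = (j,k) with i < j < k, and let G1, G2, G3 be the three graphs obtained by the reduction of G0 on (r1,r2). Inside the flow polytope F_{G̃0} := F_{G̃0}(1,0,...,0,-1), define Q1 = F_{G̃0} ∩ {f : f(r1) ≥ f(r2)}, Q2 = F_{G̃0} ∩ {f : f(r1) ≤ f(r2)}, and Q3 = F_{G̃0} ∩ {f : f(r1) = f(r2)}. Then: Q1 ∪ Q2 = F_{G̃0}; the relative interiors of Q1 and Q2 are disjoint; Q1 ∩ Q2 = Q3; for each m ∈ {1,2,3}, Q_m is integrally equivalent to F_{G̃m}; Q1 and Q2 have the same dimension as F_{G̃0}; and Q3 has dimension one less than F_{G̃0}. -/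
noncomputable section

open Finset

/-- The flow polytope of a directed graph with edge index set `ι`, edges `e` going from
`src e` to `tgt e`, and netflow vector `a`. -/
def flowPolytope {V ι : Type*} [Fintype ι] [DecidableEq V]
    (src tgt : ι → V) (a : V → ℝ) : Set (ι → ℝ) :=
  {f | (∀ e, 0 ≤ f e) ∧
    ∀ v, (∑ e, if src e = v then f e else 0) - (∑ e, if tgt e = v then f e else 0) = a v}

/-- Integral equivalence of polytopes. -/
def IntegrallyEquivalent {ι κ : Type*} (P : Set (ι → ℝ)) (Q : Set (κ → ℝ)) : Prop :=
  ∃ T : (ι → ℝ) →ᵃ[ℝ] (κ → ℝ),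
    Set.BijOn T P Q ∧
    Set.BijOn T ((affineSpan ℝ P : Set (ι → ℝ)) ∩ {f | ∀ i, ∃ z : ℤ, f i = (z : ℝ)})
      ((affineSpan ℝ Q : Set (κ → ℝ)) ∩ {f | ∀ i, ∃ z : ℤ, f i = (z : ℝ)})

/-- The dimension of a subset of a coordinate space: the rank of the direction of its
affine span. -/
def polyDim {ι : Type*} (P : Set (ι → ℝ)) : ℕ :=
  Module.finrank ℝ (affineSpan ℝ P).direction

/-- The vertex `i ∈ [0,n]` viewed inside the vertex set `{s} ∪ [0,n] ∪ {t}` of `G̃`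
(modeled as `Fin (n+3)`, with `s = 0` and `t = n+2`). -/
def embedV (n : ℕ) (v : Fin (n + 1)) : Fin (n + 3) := ⟨(v : ℕ) + 1, by omega⟩

/-- Source map of `G̃` : the edges of `G̃` are the edges of `G` (indexed by `ι`) together
with one edge `(s,i)` and one edge `(i,t)` for each `i ∈ [0,n]`. -/
def tildeSrc {n : ℕ} {ι : Type*} (src : ι → Fin (n + 1)) :
    ι ⊕ Fin (n + 1) ⊕ Fin (n + 1) → Fin (n + 3)
  | Sum.inl e => embedV n (src e)
  | Sum.inr (Sum.inl _) => 0
  | Sum.inr (Sum.inr i) => embedV n i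

/-- Target map of `G̃`. -/
def tildeTgt {n : ℕ} {ι : Type*} (tgt : ι → Fin (n + 1)) :
    ι ⊕ Fin (n + 1) ⊕ Fin (n + 1) → Fin (n + 3)
  | Sum.inl e => embedV n (tgt e)
  | Sum.inr (Sum.inl i) => embedV n i
  | Sum.inr (Sum.inr _) => Fin.last (n + 2)

/-- The netflow vector `(1, 0, …, 0, -1)` on the vertices of `G̃`. -/
def tildeNet (n : ℕ) : Fin (n + 3) → ℝ :=
  fun v => if v = 0 then 1 else if v = Fin.last (n + 2) then -1 else 0

/-- The flow polytope `F_{G̃} = F_{G̃}(1,0,…,0,-1)`. -/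
def tildePolytope {n : ℕ} {ι : Type*} [Fintype ι] (src tgt : ι → Fin (n + 1)) :
    Set ((ι ⊕ Fin (n + 1) ⊕ Fin (n + 1)) → ℝ) :=
  flowPolytope (tildeSrc src) (tildeTgt tgt) (tildeNet n)

section AffineGeometry

variable {E : Type*} [AddCommGroup E] [Module ℝ E]

/-- Each point of a convex set on the nonpositive side of a hyperplane lies in the affine span of
the section by that hyperplane together with a point strictly on the positive side. -/
theorem mem_affineSpan_insert_section {P : Set E} (hP : Convex ℝ P) (d : E →ₗ[ℝ] ℝ) {x y : E}
    (hx : x ∈ P) (hy : y ∈ P) (hdx : d x ≤ 0) (hdy : 0 < d y) :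
    x ∈ affineSpan ℝ (insert y (P ∩ {x | d x = 0})) := by
  have hpos : 0 < d y - d x := by linarith
  have hz := hP.lineMap_mem hy hx (t := d y / (d y - d x))
    ⟨by positivity, (div_le_one hpos).2 (by linarith)⟩
  have hdz : d (AffineMap.lineMap y x (d y / (d y - d x))) = 0 := by
    simp only [AffineMap.lineMap_apply_module, map_add, map_smul, smul_eq_mul]
    field_simp
    ring
  have hx' : x = AffineMap.lineMap y (AffineMap.lineMap y x (d y / (d y - d x)))
      ((d y / (d y - d x))⁻¹) := by
    rw [AffineMap.lineMap_lineMap_right, inv_mul_cancel₀ (by positivity),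
      AffineMap.lineMap_apply_one]
  rw [hx']
  exact AffineMap.lineMap_mem _ (subset_affineSpan ℝ _ (Set.mem_insert _ _))
    (subset_affineSpan ℝ _ (Set.mem_insert_of_mem _ ⟨hz, hdz⟩))

/-- A convex set lies in the affine span of its part on one side of a hyperplane through the
origin, provided that it has a point strictly on that side. -/
theorem affineSpan_inter_halfSpace {P : Set E} (hP : Convex ℝ P) (d : E →ₗ[ℝ] ℝ) {y : E}
    (hy : y ∈ P) (hdy : 0 < d y) :
    affineSpan ℝ (P ∩ {x | 0 ≤ d x}) = affineSpan ℝ P := by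
  refine le_antisymm (affineSpan_mono ℝ Set.inter_subset_left) (affineSpan_le.2 fun x hx => ?_)
  obtain hdx | hdx := le_total 0 (d x)
  · exact subset_affineSpan ℝ _ ⟨hx, hdx⟩
  · have hsub : insert y (P ∩ {x | d x = 0}) ⊆ P ∩ {x | 0 ≤ d x} :=
      Set.insert_subset ⟨hy, hdy.le⟩ fun z hz => ⟨hz.1, hz.2.ge⟩
    exact affineSpan_mono ℝ hsub (mem_affineSpan_insert_section hP d hx hy hdx hdy)

theorem affineSpan_insert_section {P : Set E} (hP : Convex ℝ P) (d : E →ₗ[ℝ] ℝ) {y w : E}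
    (hy : y ∈ P) (hw : w ∈ P) (hdy : 0 < d y) (hdw : d w < 0) :
    affineSpan ℝ (insert y (P ∩ {x | d x = 0})) = affineSpan ℝ P := by
  refine le_antisymm
    (affineSpan_mono ℝ (Set.insert_subset hy Set.inter_subset_left))
    (affineSpan_le.2 fun x hx => ?_)
  obtain hdx | hdx := le_or_gt (d x) 0
  · exact mem_affineSpan_insert_section hP d hx hy hdx hdy
  · have h := mem_affineSpan_insert_section hP (-d) hx hw (by simpa using hdx.le)
      (by simpa using hdw)
    simp only [LinearMap.neg_apply, neg_eq_zero] at h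
    refine affineSpan_le.2 (Set.insert_subset ?_ ?_) h
    · exact mem_affineSpan_insert_section hP d hw hy hdw.le hdy
    · exact (Set.subset_insert _ _).trans (subset_affineSpan ℝ _)

/-- The section of a convex set by a hyperplane with points on both sides has codimension one. -/
theorem finrank_direction_section [FiniteDimensional ℝ E] {P : Set E} (hP : Convex ℝ P)
    (d : E →ₗ[ℝ] ℝ) {y w : E} (hy : y ∈ P) (hw : w ∈ P) (hdy : 0 < d y) (hdw : d w < 0) :
    Module.finrank ℝ (affineSpan ℝ (P ∩ {x | d x = 0})).direction + 1 =
      Module.finrank ℝ (affineSpan ℝ P).direction := by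
  refine le_antisymm ?_ ?_
  · refine Nat.succ_le_of_lt (Submodule.finrank_lt_finrank_of_lt (lt_of_le_of_ne
      (AffineSubspace.direction_le (affineSpan_mono ℝ Set.inter_subset_left)) fun h => ?_))
    have hker : (affineSpan ℝ (P ∩ {x | d x = 0})).direction ≤ LinearMap.ker d := by
      rw [direction_affineSpan, vectorSpan_def, Submodule.span_le]
      rintro _ ⟨a, ha, b, hb, rfl⟩
      simp [ha.2.out, hb.2.out]
    have hyw : y -ᵥ w ∈ (affineSpan ℝ P).direction :=
      AffineSubspace.vsub_mem_direction (subset_affineSpan ℝ _ hy) (subset_affineSpan ℝ _ hw)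
    rw [← h] at hyw
    have := hker hyw
    simp only [vsub_eq_sub, LinearMap.mem_ker, map_sub] at this
    linarith
  · rw [← affineSpan_insert_section hP d hy hw hdy hdw, direction_affineSpan,
      direction_affineSpan]
    exact finrank_vectorSpan_insert_le_set ℝ _ _

/-- From a relative interior point, one may move a little away from any point of the affine
span. -/
theorem exists_lineMap_mem_of_mem_intrinsicInterior [TopologicalSpace E] [IsTopologicalAddGroup E]
    [ContinuousSMul ℝ E] {s : Set E} {x y : E} (hx : x ∈ intrinsicInterior ℝ s)
    (hy : y ∈ affineSpan ℝ s) : ∃ t : ℝ, 1 < t ∧ AffineMap.lineMap y x t ∈ s := by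
  obtain ⟨x, hxs, rfl⟩ := mem_intrinsicInterior.1 hx
  let γ : ℝ → affineSpan ℝ s := fun t =>
    ⟨AffineMap.lineMap y (x : E) t, AffineMap.lineMap_mem t hy x.2⟩
  have hγ : Continuous γ := by
    refine Continuous.subtype_mk AffineMap.lineMap_continuous _
  have hγ1 : γ 1 = x := Subtype.ext (AffineMap.lineMap_apply_one _ _)
  have hev : ∀ᶠ t in nhds (1 : ℝ), γ t ∈ ((↑) ⁻¹' s : Set (affineSpan ℝ s)) :=
    hγ.continuousAt.preimage_mem_nhds (hγ1.symm ▸ mem_interior_iff_mem_nhds.1 hxs)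
  obtain ⟨t, ht, ht1⟩ :=
    ((hev.filter_mono nhdsWithin_le_nhds).and (self_mem_nhdsWithin (s := Set.Ioi 1))).exists
  exact ⟨t, ht1, ht⟩

end AffineGeometry

/-- The set of points with integer coordinates. -/
def integerPoints (ι : Type*) : Set (ι → ℝ) := {f | ∀ i, ∃ z : ℤ, f i = (z : ℝ)}

/-- Mutually inverse linear maps between two sets which preserve integer points give an integral
equivalence. -/
theorem IntegrallyEquivalent.of_invOn {ι κ : Type*} {P : Set (ι → ℝ)} {Q : Set (κ → ℝ)}
    (T : (ι → ℝ) →ₗ[ℝ] (κ → ℝ)) (S : (κ → ℝ) →ₗ[ℝ] (ι → ℝ))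
    (hT : Set.MapsTo T P Q) (hS : Set.MapsTo S Q P)
    (hST : ∀ f ∈ P, S (T f) = f) (hTS : ∀ g ∈ Q, T (S g) = g)
    (hTint : Set.MapsTo T (integerPoints ι) (integerPoints κ))
    (hSint : Set.MapsTo S (integerPoints κ) (integerPoints ι)) :
    IntegrallyEquivalent P Q := by
  have hSTspan : Set.EqOn (S.toAffineMap.comp T.toAffineMap) (AffineMap.id ℝ _)
      (affineSpan ℝ P) := AffineMap.eqOn_affineSpan hST
  have hTSspan : Set.EqOn (T.toAffineMap.comp S.toAffineMap) (AffineMap.id ℝ _)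
      (affineSpan ℝ Q) := AffineMap.eqOn_affineSpan hTS
  have hTspan : affineSpan ℝ P ≤ (affineSpan ℝ Q).comap T.toAffineMap :=
    affineSpan_le.2 fun f hf => subset_affineSpan ℝ _ (hT hf)
  have hSspan : affineSpan ℝ Q ≤ (affineSpan ℝ P).comap S.toAffineMap :=
    affineSpan_le.2 fun g hg => subset_affineSpan ℝ _ (hS hg)
  exact ⟨T.toAffineMap, Set.InvOn.bijOn ⟨hST, hTS⟩ hT hS,
    Set.InvOn.bijOn (f' := S) ⟨fun f hf => hSTspan hf.1, fun g hg => hTSspan hg.1⟩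
      (fun f hf => ⟨hTspan hf.1, hTint hf.2⟩) (fun g hg => ⟨hSspan hg.1, hSint hg.2⟩)⟩

section Netflow

variable {V ι : Type*} [Fintype ι] [DecidableEq V]

/-- The netflow of a function on the edges, as a function on the vertices. -/
def netflow (src tgt : ι → V) : (ι → ℝ) →ₗ[ℝ] (V → ℝ) :=
  ∑ e, (LinearMap.proj e : (ι → ℝ) →ₗ[ℝ] ℝ).smulRight
    (Pi.single (src e) 1 - Pi.single (tgt e) 1)

theorem netflow_apply (src tgt : ι → V) (f : ι → ℝ) :
    netflow src tgt f = ∑ e, f e • (Pi.single (src e) 1 - Pi.single (tgt e) 1 : V → ℝ) := by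
  simp [netflow]

theorem netflow_single [DecidableEq ι] (src tgt : ι → V) (e : ι) :
    netflow src tgt (Pi.single e 1) = Pi.single (src e) 1 - Pi.single (tgt e) 1 := by
  rw [netflow_apply, Fintype.sum_eq_single e (fun x hx => by simp [hx])]
  simp

theorem mem_flowPolytope_iff {src tgt : ι → V} {a : V → ℝ} {f : ι → ℝ} :
    f ∈ flowPolytope src tgt a ↔ (∀ e, 0 ≤ f e) ∧ netflow src tgt f = a := by
  refine and_congr_right fun _ => ?_
  rw [funext_iff]
  refine forall_congr' fun v => ?_
  simp [netflow_apply, Finset.sum_apply, Pi.single_apply, mul_sub, eq_comm]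

theorem convex_flowPolytope (src tgt : ι → V) (a : V → ℝ) :
    Convex ℝ (flowPolytope src tgt a) := by
  intro f hf g hg s t hs ht hst
  rw [mem_flowPolytope_iff] at *
  refine ⟨fun e => ?_, ?_⟩
  · have := hf.1 e
    have := hg.1 e
    simp only [Pi.add_apply, Pi.smul_apply, smul_eq_mul]
    positivity
  · rw [map_add, map_smul, map_smul, hf.2, hg.2, ← add_smul, hst, one_smul]

end Netflow

section Shear

variable {ι : Type*} [DecidableEq ι]

/-- The linear map adding `c` times the coordinate `b` to the coordinate `a`. -/
def shear (a b : ι) (c : ℝ) : (ι → ℝ) →ₗ[ℝ] (ι → ℝ) :=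
  LinearMap.id + (c • (LinearMap.proj b : (ι → ℝ) →ₗ[ℝ] ℝ)).smulRight (Pi.single a 1)

theorem shear_apply (a b : ι) (c : ℝ) (f : ι → ℝ) (e : ι) :
    shear a b c f e = f e + if e = a then c * f b else 0 := by
  simp [shear, Pi.single_apply]

theorem shear_neg_shear {a b : ι} (hab : a ≠ b) (c : ℝ) (f : ι → ℝ) :
    shear a b (-c) (shear a b c f) = f := by
  ext e
  by_cases h : e = a <;> simp [shear_apply, h, hab.symm]

theorem mapsTo_shear_integerPoints (a b : ι) (c : ℤ) :
    Set.MapsTo (shear a b (c : ℝ)) (integerPoints ι) (integerPoints ι) := by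
  intro f hf e
  obtain ⟨x, hx⟩ := hf e
  obtain ⟨y, hy⟩ := hf b
  refine ⟨x + if e = a then c * y else 0, ?_⟩
  rw [shear_apply, hx, hy]
  split_ifs <;> push_cast <;> rfl

end Shear

section Reduction

variable {V ι : Type*} [Fintype ι] [DecidableEq V] [DecidableEq ι]

/-- Shearing by two consecutive edges transports the flows with `f b ≤ f a` to the flows on the
graph where `b` is replaced by an edge whose netflow is that of the path formed by `a` and `b`. -/
theorem integrallyEquivalent_flowPolytope {src tgt src' tgt' : ι → V} (w : V → ℝ) {a b : ι}
    (hab : a ≠ b) (hsrc : ∀ e, e ≠ b → src' e = src e) (htgt : ∀ e, e ≠ b → tgt' e = tgt e)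
    (hb : (Pi.single (src' b) 1 - Pi.single (tgt' b) 1 : V → ℝ) =
      (Pi.single (src a) 1 - Pi.single (tgt a) 1) + (Pi.single (src b) 1 - Pi.single (tgt b) 1)) :
    IntegrallyEquivalent (flowPolytope src tgt w ∩ {f | f b ≤ f a})
      (flowPolytope src' tgt' w) := by
  have hnet : ∀ f, netflow src' tgt' (shear a b (-1) f) = netflow src tgt f := by
    intro f
    rw [← sub_eq_zero, netflow_apply, netflow_apply, ← Finset.sum_sub_distrib,
      Fintype.sum_eq_add a b hab]
    · rw [hb, hsrc a hab, htgt a hab]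
      simp only [shear_apply, hab.symm, if_true, if_false]
      module
    · rintro e ⟨hea, heb⟩
      simp [shear_apply, hea, hsrc e heb, htgt e heb]
  have hinv : ∀ f, shear a b (-1) (shear a b 1 f) = f := shear_neg_shear hab 1
  have hinv' : ∀ f, shear a b 1 (shear a b (-1) f) = f := fun f => by
    simpa using shear_neg_shear hab (-1) f
  refine .of_invOn (shear a b (-1)) (shear a b 1) ?_ ?_ (fun f _ => hinv' f) (fun f _ => hinv f)
    (by simpa using mapsTo_shear_integerPoints a b (-1))
    (by simpa using mapsTo_shear_integerPoints a b 1)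
  · rintro f ⟨hf, hfab⟩
    rw [mem_flowPolytope_iff] at *
    refine ⟨fun e => ?_, (hnet f).trans hf.2⟩
    have := hf.1 e
    have := hfab.out
    rw [shear_apply]
    split_ifs with h
    · subst h; linarith
    · linarith
  · intro g hg
    rw [mem_flowPolytope_iff] at hg
    refine ⟨mem_flowPolytope_iff.2 ⟨fun e => ?_, by rw [← hnet, hinv, hg.2]⟩, ?_⟩
    · have := hg.1 e
      have := hg.1 b
      rw [shear_apply]
      split_ifs <;> linarith
    · simpa [shear_apply, hab.symm] using hg.1 a

/-- Flows which agree on two consecutive edges `a`, `b` correspond to flows on the graph with edge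
set `κ ≃ ι ∖ {a}`, where `b` is replaced by an edge whose netflow is that of the path formed by
`a` and `b`. -/
theorem integrallyEquivalent_flowPolytope_contract {κ : Type*} [Fintype κ] {src tgt : ι → V}
    {src' tgt' : κ → V} (w : V → ℝ) {a b : ι} (hab : a ≠ b) (φ : κ → ι) (ψ : ι → κ)
    (hψφ : ∀ x, ψ (φ x) = x) (hφψ : ∀ e, e ≠ a → φ (ψ e) = e) (hφ : ∀ x, φ x ≠ a)
    (hψ : ψ a = ψ b)
    (hsrc : ∀ x, φ x ≠ b → src' x = src (φ x)) (htgt : ∀ x, φ x ≠ b → tgt' x = tgt (φ x))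
    (hb : (Pi.single (src' (ψ b)) 1 - Pi.single (tgt' (ψ b)) 1 : V → ℝ) =
      (Pi.single (src a) 1 - Pi.single (tgt a) 1) + (Pi.single (src b) 1 - Pi.single (tgt b) 1)) :
    IntegrallyEquivalent (flowPolytope src tgt w ∩ {f | f a = f b})
      (flowPolytope src' tgt' w) := by
  have hinv : ∀ f : ι → ℝ, f a = f b → (f ∘ φ) ∘ ψ = f := by
    intro f hf
    ext e
    by_cases h : e = a
    · subst h; simp [hψ, hφψ b hab.symm, hf]
    · simp [hφψ e h]
  have hnet : ∀ f : ι → ℝ, f a = f b → netflow src' tgt' (f ∘ φ) = netflow src tgt f := by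
    intro f hf
    rw [netflow_apply, netflow_apply, Finset.sum_of_injOn (t := Finset.univ)
      (g := fun e => if e = a then 0 else
        f e • (Pi.single (src' (ψ e)) 1 - Pi.single (tgt' (ψ e)) 1 : V → ℝ)) φ
      (Function.LeftInverse.injective hψφ).injOn (by simp)
      (fun e _ he => if_pos (by
        by_contra h
        exact he ⟨ψ e, by simp, hφψ e h⟩))
      (fun x _ => by simp [hφ, hψφ]),
      ← sub_eq_zero, ← Finset.sum_sub_distrib, Fintype.sum_eq_add a b hab]
    · rw [hb]
      simp only [hab.symm, if_true, if_false, hf]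
      module
    · rintro e ⟨hea, heb⟩
      have h := hφψ e hea
      have hb' : φ (ψ e) ≠ b := by rwa [h]
      simp [hea, hsrc (ψ e) hb', htgt (ψ e) hb', h]
  have hcomp : ∀ g : κ → ℝ, (g ∘ ψ) ∘ φ = g := fun g => by ext x; simp [hψφ]
  refine .of_invOn (LinearMap.funLeft ℝ ℝ φ) (LinearMap.funLeft ℝ ℝ ψ) ?_ ?_
    (fun f hf => hinv f hf.2) (fun g _ => hcomp g) (fun f hf x => hf (φ x))
    (fun g hg e => hg (ψ e))
  · rintro f ⟨hf, hfab⟩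
    rw [mem_flowPolytope_iff] at *
    exact ⟨fun x => hf.1 (φ x), (hnet f hfab).trans hf.2⟩
  · intro g hg
    rw [mem_flowPolytope_iff] at hg
    have hgab : (g ∘ ψ) a = (g ∘ ψ) b := congrArg g hψ
    exact ⟨mem_flowPolytope_iff.2
      ⟨fun e => hg.1 (ψ e), (hnet (g ∘ ψ) hgab).symm.trans (by rw [hcomp, hg.2])⟩, hgab⟩

end Reduction

/-- The unit flow along the path `s → src r → tgt r → t`. -/
theorem exists_mem_tildePolytope {n : ℕ} {ι : Type*} [Fintype ι] [DecidableEq ι]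
    (src tgt : ι → Fin (n + 1)) {r r' : ι} (hr : r ≠ r') :
    ∃ f ∈ tildePolytope src tgt, f (Sum.inl r') < f (Sum.inl r) := by
  refine ⟨Pi.single (Sum.inr (Sum.inl (src r))) 1 + Pi.single (Sum.inl r) 1 +
    Pi.single (Sum.inr (Sum.inr (tgt r))) 1, mem_flowPolytope_iff.2 ⟨fun e => ?_, ?_⟩, ?_⟩
  · simp only [Pi.add_apply, Pi.single_apply]
    positivity
  · rw [map_add, map_add, netflow_single, netflow_single, netflow_single]
    ext v
    have hlast : (0 : Fin (n + 3)) ≠ Fin.last (n + 2) := by simp [Fin.ext_iff]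
    simp only [tildeSrc, tildeTgt, tildeNet, Pi.add_apply, Pi.sub_apply, Pi.single_apply]
    by_cases h0 : v = 0
    · simp [h0, hlast]
    · simp [h0]; split_ifs <;> ring
  · simp [hr.symm]

/-- Proposition: subdivision lemma.  Let `G₀` be a graph on `[0,n]`
containing edges `r1 = (i,j)` and `r2 = (j,k)` with `i < j < k`, and let `G₁, G₂, G₃` be
the outcomes of the reduction on `(r1, r2)`.  Cutting `F_{G̃₀}` by the hyperplane
`f(r1) = f(r2)` yields `Q₁, Q₂, Q₃` such that `Q₁ ∪ Q₂ = F_{G̃₀}`, the relative interiors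
of `Q₁` and `Q₂` are disjoint, `Q₁ ∩ Q₂ = Q₃`, each `Qₘ` is integrally equivalent to
`F_{G̃ₘ}`, `Q₁` and `Q₂` have the same dimension as `F_{G̃₀}` and `Q₃` has dimension one
less. -/
theorem subdivision_lemma (n : ℕ) {ι : Type*} [Fintype ι] [DecidableEq ι]
    (src tgt : ι → Fin (n + 1)) (hdir : ∀ e, src e < tgt e)
    (r1 r2 : ι) (hne : r1 ≠ r2) (vi vj vk : Fin (n + 1)) (hij : vi < vj) (hjk : vj < vk)
    (hr1s : src r1 = vi) (hr1t : tgt r1 = vj) (hr2s : src r2 = vj) (hr2t : tgt r2 = vk)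
    (Q1 Q2 Q3 : Set ((ι ⊕ Fin (n + 1) ⊕ Fin (n + 1)) → ℝ))
    (hQ1 : Q1 = tildePolytope src tgt ∩ {f | f (Sum.inl r2) ≤ f (Sum.inl r1)})
    (hQ2 : Q2 = tildePolytope src tgt ∩ {f | f (Sum.inl r1) ≤ f (Sum.inl r2)})
    (hQ3 : Q3 = tildePolytope src tgt ∩ {f | f (Sum.inl r1) = f (Sum.inl r2)}) :
    Q1 ∪ Q2 = tildePolytope src tgt ∧
    intrinsicInterior ℝ Q1 ∩ intrinsicInterior ℝ Q2 = ∅ ∧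
    Q1 ∩ Q2 = Q3 ∧
    -- `G₁ = G₀ - r2 + (i,k)` : the edge `r2` is replaced by the new edge `(i,k)`.
    IntegrallyEquivalent Q1
      (tildePolytope (fun e => if e = r2 then vi else src e)
        (fun e => if e = r2 then vk else tgt e)) ∧
    -- `G₂ = G₀ - r1 + (i,k)` : the edge `r1` is replaced by the new edge `(i,k)`.
    IntegrallyEquivalent Q2
      (tildePolytope (fun e => if e = r1 then vi else src e)
        (fun e => if e = r1 then vk else tgt e)) ∧
    -- `G₃ = G₀ - r1 - r2 + (i,k)` : `r1` is deleted and `r2` is replaced by `(i,k)`.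
    IntegrallyEquivalent Q3
      (tildePolytope (fun e : {e : ι // e ≠ r1} => if e.1 = r2 then vi else src e.1)
        (fun e : {e : ι // e ≠ r1} => if e.1 = r2 then vk else tgt e.1)) ∧
    polyDim Q1 = polyDim (tildePolytope src tgt) ∧
    polyDim Q2 = polyDim (tildePolytope src tgt) ∧
    polyDim Q3 + 1 = polyDim (tildePolytope src tgt) := by
  classical
  let a : ι ⊕ Fin (n + 1) ⊕ Fin (n + 1) := Sum.inl r1
  let b : ι ⊕ Fin (n + 1) ⊕ Fin (n + 1) := Sum.inl r2
  have hab : a ≠ b := fun h => hne (Sum.inl_injective h)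
  let d : ((ι ⊕ Fin (n + 1) ⊕ Fin (n + 1)) → ℝ) →ₗ[ℝ] ℝ :=
    (LinearMap.proj a : (_ → ℝ) →ₗ[ℝ] ℝ) - LinearMap.proj b
  have hconv : Convex ℝ (tildePolytope src tgt) := convex_flowPolytope _ _ _
  obtain ⟨y, hy, hya⟩ := exists_mem_tildePolytope src tgt hne
  obtain ⟨w, hw, hwa⟩ := exists_mem_tildePolytope src tgt hne.symm
  have hdy : 0 < d y := sub_pos.2 hya
  have hdw : d w < 0 := sub_neg.2 hwa
  have hQ1' : Q1 = tildePolytope src tgt ∩ {f | 0 ≤ d f} := by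
    rw [hQ1]; ext f; simp [d, a, b]
  have hQ2' : Q2 = tildePolytope src tgt ∩ {f | 0 ≤ (-d) f} := by
    rw [hQ2]; ext f; simp [d, a, b]
  have hQ3' : Q3 = tildePolytope src tgt ∩ {f | d f = 0} := by
    rw [hQ3]; ext f; simp [d, a, b, sub_eq_zero]
  refine ⟨?_, ?_, ?_, ?_, ?_, ?_, ?_, ?_, ?_⟩
  · rw [hQ1, hQ2, ← Set.inter_union_distrib_left]
    exact Set.inter_eq_left.2 fun f _ => le_total (f b) (f a)
  · refine Set.eq_empty_of_forall_notMem fun x ⟨hx1, hx2⟩ => ?_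
    obtain ⟨t, ht, htm⟩ := exists_lineMap_mem_of_mem_intrinsicInterior hx1
      (subset_affineSpan ℝ Q1 (show y ∈ Q1 from hQ1' ▸ ⟨hy, hdy.le⟩))
    have hx := intrinsicInterior_subset hx2
    rw [hQ2'] at hx
    rw [hQ1'] at htm
    have h1 : 0 ≤ -d x := hx.2
    have h2 : 0 ≤ d (AffineMap.lineMap y x t) := htm.2
    simp only [AffineMap.lineMap_apply_module, map_add, map_smul, smul_eq_mul] at h2
    nlinarith
  · rw [hQ1, hQ2, hQ3, ← Set.inter_inter_distrib_left]
    congr 1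
    ext f
    exact ⟨fun h => le_antisymm h.2 h.1, fun h => ⟨h.out.ge, h.out.le⟩⟩
  · rw [hQ1]
    refine integrallyEquivalent_flowPolytope _ hab ?_ ?_ ?_
    · rintro (e | e | e) he <;> simp_all [tildeSrc, b]
    · rintro (e | e | e) he <;> simp_all [tildeTgt, b]
    · simp [tildeSrc, tildeTgt, hr1s, hr1t, hr2s, hr2t]
  · rw [hQ2]
    refine integrallyEquivalent_flowPolytope _ hab.symm ?_ ?_ ?_
    · rintro (e | e | e) he <;> simp_all [tildeSrc, a]
    · rintro (e | e | e) he <;> simp_all [tildeTgt, a]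
    · simp [tildeSrc, tildeTgt, hr1s, hr1t, hr2s, hr2t]
  · rw [hQ3]
    refine integrallyEquivalent_flowPolytope_contract _ hab (Sum.map Subtype.val id)
      (Sum.map (fun e => if h : e = r1 then ⟨r2, hne.symm⟩ else ⟨e, h⟩) id)
      ?_ ?_ ?_ ?_ ?_ ?_ ?_
    · rintro (⟨e, he⟩ | e)
      · simp [he]
      · simp
    · rintro (e | e) he
      · have he' : e ≠ r1 := fun h => he (congrArg Sum.inl h)
        simp [he']
      · rfl
    · rintro (⟨e, he⟩ | e)
      · simp [he]
      · simp
    · simp [hne.symm]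
    · rintro (⟨e, he⟩ | e | e) h <;> simp_all [tildeSrc, b]
    · rintro (⟨e, he⟩ | e | e) h <;> simp_all [tildeTgt, b]
    · simp [tildeSrc, tildeTgt, hr1s, hr1t, hr2s, hr2t, hne.symm]
  · rw [hQ1', polyDim, affineSpan_inter_halfSpace hconv d hy hdy, polyDim]
  · rw [hQ2', polyDim, affineSpan_inter_halfSpace hconv (-d) hw (neg_pos.2 hdw), polyDim]
  · rw [hQ3']
    exact finrank_direction_section hconv d hy hw hdy hdw
end
end

section
/- Let G be a simple graph on [0,n] and F ⊆ E(G\0). Then the solution set Poly(Tri_G(F)) ⊆ ℝ^{n(n+1)/2} of the constraint system Tri_G(F) is integrally equivalent to the flow polytope F_{Gr(G)}(a_G^F). In particular, the integer solutions of Tri_G(F) are precisely the restrictions of the integral flows on Gr(G) with netflow a_G^F to the coordinates indexed by the edges a_{i,j}. -/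
noncomputable section

open Finset

/-- `E(G\0)`: the edges of `G` not incident to the vertex `0`. -/
def EG0 (n : ℕ) (G : Finset (Fin (n + 1) × Fin (n + 1))) :
    Finset (Fin (n + 1) × Fin (n + 1)) :=
  G.filter fun e => (e.1 : ℕ) ≠ 0

/-- `indeg_G(v)`: number of edges of `G` ending at `v`. -/
def indeg (n : ℕ) (G : Finset (Fin (n + 1) × Fin (n + 1))) (v : Fin (n + 1)) : ℕ :=
  (G.filter fun e => e.2 = v).card

/-- The index set `{(i,j) : 1 ≤ j ≤ i ≤ n}` of the variables `a_{i,j}` of the triangular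
constraint array (a pair `p` encodes `i = p.1`, `j = p.2`). -/
abbrev TriIdx (n : ℕ) : Type :=
  {p : Fin (n + 1) × Fin (n + 1) // 1 ≤ (p.2 : ℕ) ∧ (p.2 : ℕ) ≤ (p.1 : ℕ)}

/-- `f_{i,j} = #{(j,k) ∈ F : k ≤ i}`. -/
def fval (n : ℕ) (F : Finset (Fin (n + 1) × Fin (n + 1))) (i j : ℕ) : ℕ :=
  (F.filter fun e => (e.1 : ℕ) = j ∧ (e.2 : ℕ) ≤ i).card

/-- `Poly(Tri_G(F))`: the solution set of the constraint system `Tri_G(F)`, namely: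
`a_{1,1} = #{edges of G from 0 to 1}`; for `1 ≤ j < i ≤ n`,
`a_{i,j} + f_{i,j} ≤ a_{i-1,j} + f_{i-1,j}` if `(j,i) ∈ E(G)` and
`a_{i,j} + f_{i,j} = a_{i-1,j} + f_{i-1,j}` otherwise; for `1 < i ≤ n`,
`a_{i,i} = #E(G[0,i]) − ∑_{k=1}^{i-1} (a_{i,k} + f_{i,k})`; and `a_{n,j} ≥ 0`. -/
def polyTri (n : ℕ) (G F : Finset (Fin (n + 1) × Fin (n + 1))) : Set (TriIdx n → ℝ) :=
  {x |
    (∀ p : TriIdx n, (p.1.1 : ℕ) = 1 →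
      x p = ((G.filter fun e => (e.1 : ℕ) = 0 ∧ (e.2 : ℕ) = 1).card : ℝ)) ∧
    (∀ p q : TriIdx n, (p.1.2 : ℕ) = (q.1.2 : ℕ) → (q.1.1 : ℕ) + 1 = (p.1.1 : ℕ) →
      (p.1.2 : ℕ) < (p.1.1 : ℕ) →
      if (p.1.2, p.1.1) ∈ G then
        x p + (fval n F (p.1.1 : ℕ) (p.1.2 : ℕ) : ℝ) ≤
          x q + (fval n F (q.1.1 : ℕ) (q.1.2 : ℕ) : ℝ)
      else
        x p + (fval n F (p.1.1 : ℕ) (p.1.2 : ℕ) : ℝ) =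
          x q + (fval n F (q.1.1 : ℕ) (q.1.2 : ℕ) : ℝ)) ∧
    (∀ p : TriIdx n, p.1.1 = p.1.2 → 2 ≤ (p.1.1 : ℕ) →
      x p = ((G.filter fun e => (e.2 : ℕ) ≤ (p.1.1 : ℕ)).card : ℝ) -
        ∑ q ∈ Finset.univ.filter
            (fun q : TriIdx n => q.1.1 = p.1.1 ∧ (q.1.2 : ℕ) < (p.1.1 : ℕ)),
          (x q + (fval n F (q.1.1 : ℕ) (q.1.2 : ℕ) : ℝ))) ∧
    (∀ p : TriIdx n, (p.1.1 : ℕ) = n → 0 ≤ x p)}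

/-- Source map of the graph `Gr(G)`, whose vertices are the `v_{i,j}` for
`1 ≤ j ≤ i ≤ n` together with `v_{n+1,n+1}` (modeled as `Option (Fin (n+1) × Fin (n+1))`
with `none = v_{n+1,n+1}`; invalid pairs are unused isolated vertices).  Its edges are:
one edge `a_{i,j} : v_{i,j} → v_{i+1,j}` for each `1 ≤ j ≤ i ≤ n` (where `v_{n+1,j}`
means `v_{n+1,n+1}`), and one edge `z_{i,j} : v_{i,j} → v_{i,i}` for each edge
`(j,i) ∈ E(G\0)`. -/
def srcGr (n : ℕ) (G : Finset (Fin (n + 1) × Fin (n + 1))) :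
    (TriIdx n ⊕ ↥(EG0 n G)) → Option (Fin (n + 1) × Fin (n + 1))
  | Sum.inl p => some p.1
  | Sum.inr e => some (e.1.2, e.1.1)

/-- Target map of `Gr(G)`. -/
def tgtGr (n : ℕ) (G : Finset (Fin (n + 1) × Fin (n + 1))) :
    (TriIdx n ⊕ ↥(EG0 n G)) → Option (Fin (n + 1) × Fin (n + 1))
  | Sum.inl p =>
      if h : (p.1.1 : ℕ) < n then some (⟨(p.1.1 : ℕ) + 1, by omega⟩, p.1.2) else none
  | Sum.inr e => some (e.1.2, e.1.2)

/-- The netflow vector `a_G^F` on the vertices of `Gr(G)`: `indeg_G(j)` at `v_{j,j}`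
(`j ∈ [n]`), `f_{i-1,j} − f_{i,j}` at `v_{i,j}` (`1 ≤ j < i ≤ n`),
`−#E(G) + ∑_{k=1}^{n-1} f_{n,k}` at `v_{n+1,n+1}`, and `0` at the unused vertices. -/
def aGrF (n : ℕ) (G F : Finset (Fin (n + 1) × Fin (n + 1))) :
    Option (Fin (n + 1) × Fin (n + 1)) → ℝ
  | none => -(G.card : ℝ) + ∑ k ∈ Finset.Icc 1 (n - 1), (fval n F n k : ℝ)
  | some p =>
      if p.1 = p.2 then (if 1 ≤ (p.1 : ℕ) then (indeg n G p.1 : ℝ) else 0)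
      else if 1 ≤ (p.2 : ℕ) ∧ (p.2 : ℕ) < (p.1 : ℕ) then
        (fval n F ((p.1 : ℕ) - 1) (p.2 : ℕ) : ℝ) - (fval n F (p.1 : ℕ) (p.2 : ℕ) : ℝ)
      else 0

/-- The entry `a_{i,j}` of a triangular array, as a linear functional of the array; it is zero
unless `1 ≤ j ≤ i ≤ n`. -/
def triEntry (n i j : ℕ) : (TriIdx n → ℝ) →ₗ[ℝ] ℝ :=
  ∑ p ∈ Finset.univ.filter (fun p : TriIdx n => (p.1.1 : ℕ) = i ∧ (p.1.2 : ℕ) = j),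
    LinearMap.proj p

lemma triEntry_apply (n i j : ℕ) (x : TriIdx n → ℝ) :
    triEntry n i j x =
      ∑ p : TriIdx n, if (p.1.1 : ℕ) = i ∧ (p.1.2 : ℕ) = j then x p else 0 := by
  simp only [triEntry, LinearMap.sum_apply, LinearMap.proj_apply]
  rw [Finset.sum_filter]

lemma triEntry_self (n : ℕ) (x : TriIdx n → ℝ) (p : TriIdx n) :
    triEntry n p.1.1 p.1.2 x = x p := by
  rw [triEntry_apply, Finset.sum_eq_single p]
  · simp
  · intro q _ hq
    rw [if_neg]
    rintro ⟨h1, h2⟩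
    exact hq (Subtype.ext (Prod.ext (Fin.ext h1) (Fin.ext h2)))
  · simp

lemma triEntry_eq_zero (n i j : ℕ) (x : TriIdx n → ℝ) (h : ¬ (1 ≤ j ∧ j ≤ i)) :
    triEntry n i j x = 0 := by
  rw [triEntry_apply]
  refine Finset.sum_eq_zero fun p _ => if_neg ?_
  rintro ⟨rfl, rfl⟩
  exact h p.2

/-- The value `z_{i,j}` of a function on the edges of `G` not incident to `0`, extended by zero to
all pairs `(i, j)`. -/
def edgeEntry (n : ℕ) (G : Finset (Fin (n + 1) × Fin (n + 1))) (z : ↥(EG0 n G) → ℝ)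
    (i j : ℕ) : ℝ :=
  ∑ e : ↥(EG0 n G), if (e.1.2 : ℕ) = i ∧ (e.1.1 : ℕ) = j then z e else 0

lemma edgeEntry_self (n : ℕ) (G : Finset (Fin (n + 1) × Fin (n + 1))) (z : ↥(EG0 n G) → ℝ)
    (e : ↥(EG0 n G)) : edgeEntry n G z e.1.2 e.1.1 = z e := by
  rw [edgeEntry, Finset.sum_eq_single e]
  · simp
  · intro q _ hq
    rw [if_neg]
    rintro ⟨h1, h2⟩
    exact hq (Subtype.ext (Prod.ext (Fin.ext h2) (Fin.ext h1)))
  · simp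

lemma edgeEntry_eq_zero (n : ℕ) (G : Finset (Fin (n + 1) × Fin (n + 1))) (z : ↥(EG0 n G) → ℝ)
    (i j : ℕ) (h : ∀ e ∈ EG0 n G, ¬ ((e.2 : ℕ) = i ∧ (e.1 : ℕ) = j)) :
    edgeEntry n G z i j = 0 :=
  Finset.sum_eq_zero fun e _ => if_neg (h e.1 e.2)

lemma sum_edgeEntry (n : ℕ) (G : Finset (Fin (n + 1) × Fin (n + 1))) (hG : ∀ e ∈ G, e.1 < e.2)
    (z : ↥(EG0 n G) → ℝ) (i : ℕ) :
    ∑ k ∈ Finset.Ico 1 i, edgeEntry n G z i k =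
      ∑ e : ↥(EG0 n G), if (e.1.2 : ℕ) = i then z e else 0 := by
  simp only [edgeEntry]
  rw [Finset.sum_comm]
  refine Finset.sum_congr rfl fun e _ => ?_
  obtain ⟨he, he0⟩ := Finset.mem_filter.1 e.2
  have hlt : (e.1.1 : ℕ) < e.1.2 := hG _ he
  by_cases h : (e.1.2 : ℕ) = i
  · have hm : (e.1.1 : ℕ) ∈ Finset.Ico 1 i := by rw [Finset.mem_Ico]; omega
    simp [h, Finset.sum_ite_eq, Nat.one_le_iff_ne_zero, he0, h ▸ hlt]
  · simp [h]

lemma sum_triEntry_last (n : ℕ) (x : TriIdx n → ℝ) :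
    ∑ k ∈ Finset.Icc 1 n, triEntry n n k x =
      ∑ p : TriIdx n, if (p.1.1 : ℕ) = n then x p else 0 := by
  simp only [triEntry_apply]
  rw [Finset.sum_comm]
  refine Finset.sum_congr rfl fun p _ => ?_
  have h1 := p.2
  have h2 : (p.1.2 : ℕ) ≤ n := by omega
  by_cases h : (p.1.1 : ℕ) = n
  · simp [h, Finset.sum_ite_eq, h1.1, h2]
  · simp [h]

lemma netflow_some (n : ℕ) (G : Finset (Fin (n + 1) × Fin (n + 1))) (hG : ∀ e ∈ G, e.1 < e.2)
    (f : (TriIdx n ⊕ ↥(EG0 n G)) → ℝ) (v : Fin (n + 1) × Fin (n + 1)) :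
    (∑ e, if srcGr n G e = some v then f e else 0) -
        (∑ e, if tgtGr n G e = some v then f e else 0) =
      triEntry n v.1 v.2 (f ∘ Sum.inl) + edgeEntry n G (f ∘ Sum.inr) v.1 v.2 -
        (triEntry n (v.1 - 1) v.2 (f ∘ Sum.inl) +
          if v.1 = v.2 then ∑ k ∈ Finset.Ico 1 (v.1 : ℕ), edgeEntry n G (f ∘ Sum.inr) v.1 k
          else 0) := by
  rw [Fintype.sum_sum_type, Fintype.sum_sum_type, sum_edgeEntry n G hG, triEntry_apply,
    triEntry_apply, edgeEntry]
  congr 1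
  · congr 1
    · refine Finset.sum_congr rfl fun p _ => ?_
      simp [srcGr, Prod.ext_iff, Fin.ext_iff]
    · refine Finset.sum_congr rfl fun p _ => ?_
      simp [srcGr, Prod.ext_iff, Fin.ext_iff]
  · congr 1
    · refine Finset.sum_congr rfl fun p _ => if_congr ?_ rfl rfl
      have hp := p.2
      have hv := v.1.2
      by_cases h : (p.1.1 : ℕ) < n
      · simp only [tgtGr, h, dite_true, Option.some.injEq, Prod.ext_iff, Fin.ext_iff]
        omega
      · simp only [tgtGr, h, dite_false, reduceCtorEq, false_iff]
        omega
    · split_ifs with h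
      · refine Finset.sum_congr rfl fun e _ => if_congr ?_ rfl rfl
        simp [tgtGr, Prod.ext_iff, Fin.ext_iff, h]
      · refine Finset.sum_eq_zero fun e _ => if_neg fun h' => h ?_
        simp only [tgtGr, Option.some.injEq, Prod.ext_iff] at h'
        exact h'.1.symm.trans h'.2

lemma netflow_none (n : ℕ) (G : Finset (Fin (n + 1) × Fin (n + 1)))
    (f : (TriIdx n ⊕ ↥(EG0 n G)) → ℝ) :
    (∑ e, if srcGr n G e = none then f e else 0) -
        (∑ e, if tgtGr n G e = none then f e else 0) =
      -∑ k ∈ Finset.Icc 1 n, triEntry n n k (f ∘ Sum.inl) := by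
  rw [Fintype.sum_sum_type, Fintype.sum_sum_type, sum_triEntry_last]
  have h : ∀ p : TriIdx n, tgtGr n G (Sum.inl p) = none ↔ (p.1.1 : ℕ) = n := by
    intro p
    have := p.1.1.2
    by_cases h : (p.1.1 : ℕ) < n
    · simp only [tgtGr, h, dite_true, reduceCtorEq, false_iff]
      omega
    · simp only [tgtGr, h, dite_false, true_iff]
      omega
  simp only [h]
  simp [srcGr, tgtGr]

lemma fval_eq_zero_of_le (n : ℕ) (G F : Finset (Fin (n + 1) × Fin (n + 1))) (hG : ∀ e ∈ G, e.1 < e.2)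
    (hF : F ⊆ EG0 n G) {i j : ℕ} (h : i ≤ j) : fval n F i j = 0 := by
  rw [fval, Finset.card_eq_zero, Finset.filter_eq_empty_iff]
  rintro e he ⟨h1, h2⟩
  have hlt : (e.1 : ℕ) < e.2 := hG _ (Finset.mem_filter.1 (hF he)).1
  omega

lemma fval_mono (n : ℕ) (F : Finset (Fin (n + 1) × Fin (n + 1))) {i i' : ℕ} (h : i ≤ i')
    (j : ℕ) : fval n F i j ≤ fval n F i' j :=
  Finset.card_le_card (Finset.monotone_filter_right _ fun _ _ he => ⟨he.1, he.2.trans h⟩)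

lemma card_filter_snd_le (n : ℕ) (G : Finset (Fin (n + 1) × Fin (n + 1))) {i : ℕ} (hi : 1 ≤ i) :
    (G.filter fun e => (e.2 : ℕ) ≤ i).card =
      (G.filter fun e => (e.2 : ℕ) ≤ i - 1).card + (G.filter fun e => (e.2 : ℕ) = i).card := by
  rw [← Finset.card_union_of_disjoint, ← Finset.filter_or]
  · congr 1
    refine Finset.filter_congr fun e _ => ?_
    omega
  · refine Finset.disjoint_filter.2 fun e _ h1 h2 => ?_
    omega

lemma card_filter_snd_le_zero (n : ℕ) (G : Finset (Fin (n + 1) × Fin (n + 1)))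
    (hG : ∀ e ∈ G, e.1 < e.2) : (G.filter fun e => (e.2 : ℕ) ≤ 0).card = 0 := by
  rw [Finset.card_eq_zero, Finset.filter_eq_empty_iff]
  intro e he
  have hlt : (e.1 : ℕ) < e.2 := hG _ he
  omega

lemma card_filter_snd_le_one (n : ℕ) (G : Finset (Fin (n + 1) × Fin (n + 1)))
    (hG : ∀ e ∈ G, e.1 < e.2) : (G.filter fun e => (e.2 : ℕ) ≤ 1).card =
      (G.filter fun e => (e.1 : ℕ) = 0 ∧ (e.2 : ℕ) = 1).card := by
  congr 1
  refine Finset.filter_congr fun e he => ?_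
  have hlt : (e.1 : ℕ) < e.2 := hG _ he
  omega

lemma card_filter_snd_le_last (n : ℕ) (G : Finset (Fin (n + 1) × Fin (n + 1))) :
    (G.filter fun e => (e.2 : ℕ) ≤ n).card = G.card := by
  rw [Finset.filter_true_of_mem]
  intro e _
  have := e.2.2
  omega

lemma indeg_eq (n : ℕ) (G : Finset (Fin (n + 1) × Fin (n + 1))) (v : Fin (n + 1)) :
    indeg n G v = (G.filter fun e => (e.2 : ℕ) = v).card := by
  simp only [indeg, Fin.ext_iff]

/-- Telescoping of the flow conservation equations at the diagonal vertices of a triangular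
array `A` with column differences `Y`. -/
lemma sum_row_eq_iff_diag_eq (n : ℕ) (A Y : ℕ → ℕ → ℝ) (d C : ℕ → ℝ)
    (hC0 : C 0 = 0) (hC : ∀ i, 1 ≤ i → i ≤ n → C i = C (i - 1) + d i)
    (hY : ∀ i j, 1 ≤ j → j < i → i ≤ n → Y i j = A (i - 1) j - A i j) :
    (∀ i, 1 ≤ i → i ≤ n → ∑ k ∈ Finset.Icc 1 i, A i k = C i) ↔
      ∀ i, 1 ≤ i → i ≤ n → A i i - ∑ k ∈ Finset.Ico 1 i, Y i k = d i := by
  have step : ∀ i, 1 ≤ i → i ≤ n → A i i - ∑ k ∈ Finset.Ico 1 i, Y i k =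
      ∑ k ∈ Finset.Icc 1 i, A i k - ∑ k ∈ Finset.Icc 1 (i - 1), A (i - 1) k := by
    intro i hi hin
    have h1 : ∑ k ∈ Finset.Ico 1 i, Y i k =
        ∑ k ∈ Finset.Ico 1 i, A (i - 1) k - ∑ k ∈ Finset.Ico 1 i, A i k := by
      rw [← Finset.sum_sub_distrib]
      refine Finset.sum_congr rfl fun k hk => ?_
      rw [Finset.mem_Ico] at hk
      exact hY i k hk.1 hk.2 hin
    have h2 : Finset.Icc 1 (i - 1) = Finset.Ico 1 i := by
      ext k; simp only [Finset.mem_Icc, Finset.mem_Ico]; omega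
    have h3 : ∑ k ∈ Finset.Icc 1 i, A i k = ∑ k ∈ Finset.Ico 1 i, A i k + A i i := by
      rw [← Finset.sum_Ico_succ_top hi]
      rfl
    rw [h1, h2, h3]
    ring
  constructor
  · intro h i hi hin
    rw [step i hi hin, h i hi hin, hC i hi hin]
    rcases Nat.eq_or_lt_of_le hi with rfl | hi'
    · simp [hC0]
    · rw [h (i - 1) (by omega) (by omega)]
      ring
  · intro h i hi
    induction i, hi using Nat.le_induction with
    | base =>
      intro hin
      have h1 := h 1 le_rfl hin
      have h2 := hC 1 le_rfl hin
      simp only [Nat.sub_self, hC0] at h2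
      simpa [h2] using h1
    | succ i hi ih =>
      intro hin
      have h1 := step (i + 1) (by omega) hin
      rw [h (i + 1) (by omega) hin] at h1
      have h2 := hC (i + 1) (by omega) hin
      rw [Nat.add_sub_cancel] at h1 h2
      rw [ih (by omega)] at h1
      linarith

/-- The quantity `a_{i,j} + f_{i,j}`. -/
def shiftedEntry (n : ℕ) (F : Finset (Fin (n + 1) × Fin (n + 1))) (x : TriIdx n → ℝ)
    (i j : ℕ) : ℝ :=
  triEntry n i j x + fval n F i j

lemma sum_shiftedEntry_lt (n : ℕ) (F : Finset (Fin (n + 1) × Fin (n + 1))) (x : TriIdx n → ℝ)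
    (i : Fin (n + 1)) :
    ∑ q ∈ Finset.univ.filter (fun q : TriIdx n => q.1.1 = i ∧ (q.1.2 : ℕ) < (i : ℕ)),
        (x q + (fval n F (q.1.1 : ℕ) (q.1.2 : ℕ) : ℝ)) =
      ∑ k ∈ Finset.Ico 1 (i : ℕ), shiftedEntry n F x i k := by
  refine Finset.sum_bij (fun q _ => (q.1.2 : ℕ)) ?_ ?_ ?_ ?_
  · intro q hq
    rw [Finset.mem_filter] at hq
    exact Finset.mem_Ico.2 ⟨q.2.1, hq.2.2⟩
  · intro q hq q' hq' h
    rw [Finset.mem_filter] at hq hq'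
    exact Subtype.ext (Prod.ext (hq.2.1.trans hq'.2.1.symm) (Fin.ext h))
  · intro k hk
    rw [Finset.mem_Ico] at hk
    exact ⟨⟨(i, ⟨k, by omega⟩), hk.1, hk.2.le⟩, Finset.mem_filter.2 ⟨Finset.mem_univ _, rfl, hk.2⟩, rfl⟩
  · intro q hq
    rw [Finset.mem_filter] at hq
    rw [shiftedEntry, ← hq.2.1, triEntry_self]

lemma mem_polyTri_iff (n : ℕ) (G : Finset (Fin (n + 1) × Fin (n + 1)))
    (hG : ∀ e ∈ G, e.1 < e.2) (F : Finset (Fin (n + 1) × Fin (n + 1))) (hF : F ⊆ EG0 n G)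
    (x : TriIdx n → ℝ) :
    x ∈ polyTri n G F ↔
      (∀ i j, 1 ≤ j → j < i → i ≤ n → shiftedEntry n F x i j ≤ shiftedEntry n F x (i - 1) j) ∧
      (∀ i j, 1 ≤ j → j < i → i ≤ n → (∀ e ∈ G, ¬ ((e.2 : ℕ) = i ∧ (e.1 : ℕ) = j)) →
        shiftedEntry n F x i j = shiftedEntry n F x (i - 1) j) ∧
      (∀ i, 1 ≤ i → i ≤ n → ∑ k ∈ Finset.Icc 1 i, shiftedEntry n F x i k =
        (G.filter fun e => (e.2 : ℕ) ≤ i).card) ∧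
      ∀ j, 1 ≤ j → j ≤ n → 0 ≤ triEntry n n j x := by
  have hrow : ∀ i, 1 ≤ i → ∑ k ∈ Finset.Icc 1 i, shiftedEntry n F x i k =
      ∑ k ∈ Finset.Ico 1 i, shiftedEntry n F x i k + triEntry n i i x := by
    intro i hi
    have h : shiftedEntry n F x i i = triEntry n i i x := by
      rw [shiftedEntry, fval_eq_zero_of_le n G F hG hF le_rfl, Nat.cast_zero, add_zero]
    rw [← h, ← Finset.sum_Ico_succ_top hi]
    rfl
  constructor
  · rintro ⟨h1, h2, h3, h4⟩
    have hcol : ∀ i j (hj : 1 ≤ j) (hij : j < i) (hi : i ≤ n),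
        if ((⟨j, by omega⟩, ⟨i, by omega⟩) : Fin (n + 1) × Fin (n + 1)) ∈ G then
          shiftedEntry n F x i j ≤ shiftedEntry n F x (i - 1) j
        else shiftedEntry n F x i j = shiftedEntry n F x (i - 1) j := by
      intro i j hj hij hi
      have h := h2 ⟨(⟨i, by omega⟩, ⟨j, by omega⟩), hj, hij.le⟩
        ⟨(⟨i - 1, by omega⟩, ⟨j, by omega⟩), hj, Nat.le_sub_one_of_lt hij⟩ rfl
        (Nat.sub_add_cancel (by omega)) hij
      simp only [← triEntry_self n x] at h
      exact h
    refine ⟨fun i j hj hij hi => ?_, fun i j hj hij hi hne => ?_, fun i hi hin => ?_,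
      fun j hj hjn => ?_⟩
    · have h := hcol i j hj hij hi
      split_ifs at h
      exacts [h, h.le]
    · have h := hcol i j hj hij hi
      rwa [if_neg fun hmem => hne _ hmem ⟨rfl, rfl⟩] at h
    · rw [hrow i hi]
      rcases Nat.eq_or_lt_of_le hi with rfl | hi'
      · have h := h1 ⟨(⟨1, by omega⟩, ⟨1, by omega⟩), le_rfl, le_rfl⟩ rfl
        rw [← triEntry_self n x] at h
        simpa [card_filter_snd_le_one n G hG] using h
      · have h := h3 ⟨(⟨i, by omega⟩, ⟨i, by omega⟩), hi, le_rfl⟩ rfl hi'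
        rw [← triEntry_self n x, sum_shiftedEntry_lt] at h
        simp only at h
        linarith
    · have h := h4 ⟨(⟨n, by omega⟩, ⟨j, by omega⟩), hj, hjn⟩ rfl
      rwa [← triEntry_self n x] at h
  · rintro ⟨h1, h2, h3, h4⟩
    refine ⟨fun p hp => ?_, fun p q hpq hq hlt => ?_, fun p hp hp2 => ?_, fun p hp => ?_⟩
    · have hp2 : (p.1.2 : ℕ) = 1 := by have := p.2; omega
      have h := h3 1 le_rfl (by have := p.1.1.2; omega)
      rw [hrow 1 le_rfl, card_filter_snd_le_one n G hG] at h
      rw [← triEntry_self n x p, hp, hp2]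
      simpa using h
    · have hp := p.2
      have hpn := p.1.1.2
      have hq1 : (q.1.1 : ℕ) = p.1.1 - 1 := by omega
      have hle := h1 p.1.1 p.1.2 hp.1 hlt (by omega)
      have heq := h2 p.1.1 p.1.2 hp.1 hlt (by omega)
      rw [← triEntry_self n x p, ← triEntry_self n x q, hq1, ← hpq]
      split_ifs with hmem
      · exact hle
      · refine heq fun e he he' => hmem ?_
        have hep : e = (p.1.2, p.1.1) := Prod.ext (Fin.ext he'.2) (Fin.ext he'.1)
        exact hep ▸ he
    · have h := h3 p.1.1 (by omega) (by have := p.1.1.2; omega)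
      rw [hrow _ (by omega)] at h
      rw [sum_shiftedEntry_lt, ← h, ← triEntry_self n x p, ← hp]
      ring
    · have h := h4 p.1.2 p.2.1 (by have := p.1.2.2; omega)
      rwa [← triEntry_self n x p, hp]

lemma mem_flowPolytope_iff_s3 (n : ℕ) (G : Finset (Fin (n + 1) × Fin (n + 1)))
    (hG : ∀ e ∈ G, e.1 < e.2) (F : Finset (Fin (n + 1) × Fin (n + 1))) (hF : F ⊆ EG0 n G)
    (f : (TriIdx n ⊕ ↥(EG0 n G)) → ℝ) :
    f ∈ flowPolytope (srcGr n G) (tgtGr n G) (aGrF n G F) ↔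
      (∀ e, 0 ≤ f e) ∧
      (∀ i j, 1 ≤ j → j < i → i ≤ n → edgeEntry n G (f ∘ Sum.inr) i j =
        shiftedEntry n F (f ∘ Sum.inl) (i - 1) j - shiftedEntry n F (f ∘ Sum.inl) i j) ∧
      ∀ i, 1 ≤ i → i ≤ n → ∑ k ∈ Finset.Icc 1 i, shiftedEntry n F (f ∘ Sum.inl) i k =
        (G.filter fun e => (e.2 : ℕ) ≤ i).card := by
  have hdiag : ∀ i, shiftedEntry n F (f ∘ Sum.inl) i i = triEntry n i i (f ∘ Sum.inl) := by
    intro i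
    rw [shiftedEntry, fval_eq_zero_of_le n G F hG hF le_rfl, Nat.cast_zero, add_zero]
  have hE : ∀ i j : ℕ, ¬ (1 ≤ j ∧ j < i) → edgeEntry n G (f ∘ Sum.inr) i j = 0 := by
    intro i j h
    refine edgeEntry_eq_zero n G _ i j fun e he h' => h ?_
    obtain ⟨he, he0⟩ := Finset.mem_filter.1 he
    have hlt : (e.1 : ℕ) < e.2 := hG _ he
    omega
  have key := sum_row_eq_iff_diag_eq n (shiftedEntry n F (f ∘ Sum.inl))
    (edgeEntry n G (f ∘ Sum.inr)) (fun i => ((G.filter fun e => (e.2 : ℕ) = i).card : ℝ))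
    (fun i => ((G.filter fun e => (e.2 : ℕ) ≤ i).card : ℝ))
    (by simp only [card_filter_snd_le_zero n G hG, Nat.cast_zero])
    (fun i hi _ => by simp only [card_filter_snd_le n G hi, Nat.cast_add])
  constructor
  · rintro ⟨h0, hnet⟩
    have hY : ∀ i j, 1 ≤ j → j < i → i ≤ n → edgeEntry n G (f ∘ Sum.inr) i j =
        shiftedEntry n F (f ∘ Sum.inl) (i - 1) j - shiftedEntry n F (f ∘ Sum.inl) i j := by
      intro i j hj hij hi
      have h := hnet (some (⟨i, by omega⟩, ⟨j, by omega⟩))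
      rw [netflow_some n G hG] at h
      simp only [aGrF, Fin.mk.injEq, hij.ne', hj, hij, if_false, and_self, if_true] at h
      simp only [shiftedEntry]
      linarith
    refine ⟨h0, hY, (key hY).2 fun i hi hin => ?_⟩
    have h := hnet (some (⟨i, by omega⟩, ⟨i, by omega⟩))
    rw [netflow_some n G hG] at h
    simp only [aGrF, hi, if_true, indeg_eq] at h
    rw [hE i i (by omega), triEntry_eq_zero n (i - 1) i _ (by omega)] at h
    rw [hdiag]
    linarith
  · rintro ⟨h0, hY, hsum⟩
    have hd := (key hY).1 hsum
    refine ⟨h0, fun v => ?_⟩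
    rcases v with _ | ⟨i, j⟩
    · rw [netflow_none]
      simp only [aGrF]
      rcases Nat.eq_zero_or_pos n with rfl | hn
      · have h := card_filter_snd_le_last 0 G
        rw [card_filter_snd_le_zero 0 G hG] at h
        simp [← h]
      · have h := hsum n hn le_rfl
        rw [card_filter_snd_le_last] at h
        simp only [shiftedEntry, Finset.sum_add_distrib] at h
        have h' : ∑ k ∈ Finset.Icc 1 n, (fval n F n k : ℝ) =
            ∑ k ∈ Finset.Icc 1 (n - 1), (fval n F n k : ℝ) := by
          symm
          refine Finset.sum_subset (Finset.Icc_subset_Icc_right (Nat.sub_le n 1)) ?_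
          intro k hk hk'
          rw [Finset.mem_Icc] at hk hk'
          rw [fval_eq_zero_of_le n G F hG hF (by omega), Nat.cast_zero]
        linarith
    · rw [netflow_some n G hG]
      have hi := i.2
      simp only [aGrF]
      by_cases hij : i = j
      · subst hij
        rw [if_pos rfl, if_pos rfl, hE i i (by omega)]
        by_cases h1 : 1 ≤ (i : ℕ)
        · rw [if_pos h1, triEntry_eq_zero n (i - 1) i _ (by omega), indeg_eq,
            ← hd i h1 (by omega), hdiag]
          ring
        · rw [if_neg h1, triEntry_eq_zero n i i _ (by omega),
            triEntry_eq_zero n (i - 1) i _ (by omega), Finset.Ico_eq_empty (by omega)]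
          simp
      · rw [if_neg hij, if_neg hij]
        rw [Fin.ext_iff] at hij
        by_cases h1 : 1 ≤ (j : ℕ) ∧ (j : ℕ) < (i : ℕ)
        · rw [if_pos h1, hY i j h1.1 h1.2 (by omega)]
          simp only [shiftedEntry]
          ring
        · rw [if_neg h1, hE i j h1, triEntry_eq_zero n i j _ (by omega),
            triEntry_eq_zero n (i - 1) j _ (by omega)]
          simp

/-- The affine map completing a triangular array to a function on the edges of `Gr(G)`, with
`z_{i,j} = (a_{i-1,j} + f_{i-1,j}) - (a_{i,j} + f_{i,j})`. -/
def triToFlow (n : ℕ) (G F : Finset (Fin (n + 1) × Fin (n + 1))) :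
    (TriIdx n → ℝ) →ᵃ[ℝ] ((TriIdx n ⊕ ↥(EG0 n G)) → ℝ) :=
  (LinearMap.pi (Sum.elim (fun p => LinearMap.proj p) fun e : ↥(EG0 n G) =>
    triEntry n (e.1.2 - 1) e.1.1 - triEntry n e.1.2 e.1.1)).toAffineMap +
  AffineMap.const ℝ _ (Sum.elim (fun _ => 0) fun e : ↥(EG0 n G) =>
    (fval n F (e.1.2 - 1) e.1.1 - fval n F e.1.2 e.1.1 : ℝ))

lemma triToFlow_inl (n : ℕ) (G F : Finset (Fin (n + 1) × Fin (n + 1))) (x : TriIdx n → ℝ)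
    (p : TriIdx n) : triToFlow n G F x (Sum.inl p) = x p := by
  simp [triToFlow]

lemma triToFlow_comp_inl (n : ℕ) (G F : Finset (Fin (n + 1) × Fin (n + 1)))
    (x : TriIdx n → ℝ) : triToFlow n G F x ∘ Sum.inl = x :=
  funext fun p => triToFlow_inl n G F x p

lemma triToFlow_inr (n : ℕ) (G F : Finset (Fin (n + 1) × Fin (n + 1))) (x : TriIdx n → ℝ)
    (e : ↥(EG0 n G)) : triToFlow n G F x (Sum.inr e) =
      shiftedEntry n F x (e.1.2 - 1) e.1.1 - shiftedEntry n F x e.1.2 e.1.1 := by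
  simp only [triToFlow, shiftedEntry, AffineMap.coe_add, Pi.add_apply, LinearMap.coe_toAffineMap,
    LinearMap.pi_apply, Sum.elim_inr, LinearMap.sub_apply, AffineMap.const_apply]
  ring

lemma triEntry_int (n i j : ℕ) (x : TriIdx n → ℝ) (hx : ∀ p, ∃ z : ℤ, x p = z) :
    ∃ z : ℤ, triEntry n i j x = z := by
  choose y hy using hx
  refine ⟨∑ p : TriIdx n, if (p.1.1 : ℕ) = i ∧ (p.1.2 : ℕ) = j then y p else 0, ?_⟩
  rw [triEntry_apply]
  push_cast
  simp only [hy]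

lemma triToFlow_int (n : ℕ) (G F : Finset (Fin (n + 1) × Fin (n + 1))) (x : TriIdx n → ℝ)
    (hx : ∀ p, ∃ z : ℤ, x p = z) (e : TriIdx n ⊕ ↥(EG0 n G)) :
    ∃ z : ℤ, triToFlow n G F x e = z := by
  rcases e with p | e
  · rw [triToFlow_inl]
    exact hx p
  · obtain ⟨y, hy⟩ := triEntry_int n (e.1.2 - 1) e.1.1 x hx
    obtain ⟨w, hw⟩ := triEntry_int n e.1.2 e.1.1 x hx
    refine ⟨y + fval n F (e.1.2 - 1) e.1.1 - (w + fval n F e.1.2 e.1.1), ?_⟩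
    rw [triToFlow_inr, shiftedEntry, shiftedEntry, hy, hw]
    push_cast
    rfl

lemma triToFlow_mem (n : ℕ) (G : Finset (Fin (n + 1) × Fin (n + 1)))
    (hG : ∀ e ∈ G, e.1 < e.2) (F : Finset (Fin (n + 1) × Fin (n + 1))) (hF : F ⊆ EG0 n G)
    (x : TriIdx n → ℝ) (hx : x ∈ polyTri n G F) :
    triToFlow n G F x ∈ flowPolytope (srcGr n G) (tgtGr n G) (aGrF n G F) := by
  obtain ⟨hle, heq, hsum, hnn⟩ := (mem_polyTri_iff n G hG F hF x).1 hx
  rw [mem_flowPolytope_iff_s3 n G hG F hF, triToFlow_comp_inl]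
  refine ⟨?_, fun i j hj hij hi => ?_, hsum⟩
  · rintro (p | e)
    · rw [triToFlow_inl, ← triEntry_self n x p]
      have hp := p.2
      have hpn : (p.1.1 : ℕ) ≤ n := by omega
      refine Nat.decreasingInduction' (P := fun i => 0 ≤ triEntry n i p.1.2 x)
        (fun i hi hpi ih => ?_) hpn (hnn _ hp.1 (hp.2.trans hpn))
      have h := hle (i + 1) p.1.2 hp.1 (by omega) (by omega)
      have hf : (fval n F i p.1.2 : ℝ) ≤ fval n F (i + 1) p.1.2 := by
        exact_mod_cast fval_mono n F (Nat.le_succ i) p.1.2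
      simp only [shiftedEntry, Nat.add_sub_cancel] at h
      linarith
    · obtain ⟨he, he0⟩ := Finset.mem_filter.1 e.2
      have hlt : (e.1.1 : ℕ) < e.1.2 := hG _ he
      have h := hle e.1.2 e.1.1 (by omega) hlt (by omega)
      rw [triToFlow_inr]
      linarith
  · by_cases hmem : ∃ e ∈ G, (e.2 : ℕ) = i ∧ (e.1 : ℕ) = j
    · obtain ⟨e, he, rfl, rfl⟩ := hmem
      have he' : e ∈ EG0 n G := Finset.mem_filter.2 ⟨he, by omega⟩
      rw [edgeEntry_self n G _ ⟨e, he'⟩, Function.comp_apply, triToFlow_inr]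
    · push Not at hmem
      have hmem' : ∀ e ∈ G, ¬ ((e.2 : ℕ) = i ∧ (e.1 : ℕ) = j) := fun e he h => hmem e he h.1 h.2
      rw [edgeEntry_eq_zero n G _ i j fun e he => hmem' e (Finset.mem_filter.1 he).1,
        heq i j hj hij hi hmem', sub_self]

lemma flow_comp_inl_mem (n : ℕ) (G : Finset (Fin (n + 1) × Fin (n + 1)))
    (hG : ∀ e ∈ G, e.1 < e.2) (F : Finset (Fin (n + 1) × Fin (n + 1))) (hF : F ⊆ EG0 n G)
    (f : (TriIdx n ⊕ ↥(EG0 n G)) → ℝ)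
    (hf : f ∈ flowPolytope (srcGr n G) (tgtGr n G) (aGrF n G F)) :
    f ∘ Sum.inl ∈ polyTri n G F ∧ triToFlow n G F (f ∘ Sum.inl) = f := by
  obtain ⟨hnn, hY, hsum⟩ := (mem_flowPolytope_iff_s3 n G hG F hF f).1 hf
  refine ⟨(mem_polyTri_iff n G hG F hF _).2
    ⟨fun i j hj hij hi => ?_, fun i j hj hij hi hne => ?_, hsum, fun j _ _ => ?_⟩, ?_⟩
  · rw [← sub_nonneg, ← hY i j hj hij hi]
    refine Finset.sum_nonneg fun e _ => ?_
    split_ifs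
    exacts [hnn _, le_rfl]
  · have h := hY i j hj hij hi
    rw [edgeEntry_eq_zero n G _ i j fun e he => hne e (Finset.mem_filter.1 he).1] at h
    linarith
  · rw [triEntry_apply]
    refine Finset.sum_nonneg fun e _ => ?_
    split_ifs
    exacts [hnn _, le_rfl]
  · funext e
    rcases e with p | e
    · rw [triToFlow_inl, Function.comp_apply]
    · obtain ⟨he, he0⟩ := Finset.mem_filter.1 e.2
      have hlt : (e.1.1 : ℕ) < e.1.2 := hG _ he
      rw [triToFlow_inr, ← hY e.1.2 e.1.1 (by omega) hlt (by omega), edgeEntry_self,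
        Function.comp_apply]

/-- Proposition: `Poly(Tri_G(F))` is a flow polytope.  For a simple
graph `G` on `[0,n]` and `F ⊆ E(G\0)`, the solution set of the constraint system
`Tri_G(F)` is integrally equivalent to the flow polytope `F_{Gr(G)}(a_G^F)`; moreover the
integer solutions of `Tri_G(F)` are precisely the restrictions of the integral flows on
`Gr(G)` with netflow `a_G^F` to the coordinates indexed by the edges `a_{i,j}`. -/
theorem polyTri_is_flowPolytope (n : ℕ) (G : Finset (Fin (n + 1) × Fin (n + 1)))
    (hG : ∀ e ∈ G, e.1 < e.2) (F : Finset (Fin (n + 1) × Fin (n + 1)))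
    (hF : F ⊆ EG0 n G) :
    IntegrallyEquivalent (polyTri n G F)
      (flowPolytope (srcGr n G) (tgtGr n G) (aGrF n G F)) ∧
    {x | x ∈ polyTri n G F ∧ ∀ p, ∃ z : ℤ, x p = (z : ℝ)} =
      (fun f : (TriIdx n ⊕ ↥(EG0 n G)) → ℝ => fun p : TriIdx n => f (Sum.inl p)) ''
        {f | f ∈ flowPolytope (srcGr n G) (tgtGr n G) (aGrF n G F) ∧
          ∀ e, ∃ z : ℤ, f e = (z : ℝ)} := by
  have hinj : Function.Injective (triToFlow n G F) := fun x y h => by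
    rw [← triToFlow_comp_inl n G F x, h, triToFlow_comp_inl]
  have hmaps : Set.MapsTo (triToFlow n G F) (polyTri n G F)
      (flowPolytope (srcGr n G) (tgtGr n G) (aGrF n G F)) :=
    fun x hx => triToFlow_mem n G hG F hF x hx
  have himage : triToFlow n G F '' polyTri n G F =
      flowPolytope (srcGr n G) (tgtGr n G) (aGrF n G F) :=
    hmaps.image_subset.antisymm fun f hf =>
      ⟨f ∘ Sum.inl, flow_comp_inl_mem n G hG F hF f hf⟩
  refine ⟨⟨triToFlow n G F, ⟨hmaps, hinj.injOn, himage.ge⟩, ?_⟩, ?_⟩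
  · rw [← himage, ← AffineSubspace.map_span]
    refine ⟨?_, hinj.injOn, ?_⟩
    · rintro x ⟨hx, hint⟩
      exact ⟨⟨x, hx, rfl⟩, triToFlow_int n G F x hint⟩
    · rintro _ ⟨⟨x, hx, rfl⟩, hint⟩
      refine ⟨x, ⟨hx, fun p => ?_⟩, rfl⟩
      rw [← triToFlow_inl n G F x p]
      exact hint (Sum.inl p)
  · ext x
    constructor
    · rintro ⟨hx, hint⟩
      exact ⟨triToFlow n G F x, ⟨hmaps hx, triToFlow_int n G F x hint⟩,
        triToFlow_comp_inl n G F x⟩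
    · rintro ⟨f, ⟨hf, hint⟩, rfl⟩
      exact ⟨(flow_comp_inl_mem n G hG F hF f hf).1, fun p => hint (Sum.inl p)⟩
end
end

section
/- Let G be a graph on [0,n] and α = (α_0,...,α_n) ∈ ℝ^{n+1}. Then the flow polytope F_G(α) is nonempty if and only if Σ_{i=0}^{n} α_i = 0 and, for every subset S ⊆ [0,n] with outdeg_G(S) = 0 (i.e., G has no edge from a vertex in S to a vertex not in S), one has Σ_{i∈S} α_i ≤ 0. -/
noncomputable section

open Finset

theorem sum_netflow_eq {V ι : Type*} [Fintype ι] [DecidableEq V] {src tgt : ι → V} {a : V → ℝ}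
    {f : ι → ℝ} (hf : f ∈ flowPolytope src tgt a) (S : Finset V) :
    ∑ v ∈ S, a v = ∑ e, ((if src e ∈ S then f e else 0) - (if tgt e ∈ S then f e else 0)) := by
  rw [sum_congr rfl fun v _ => (hf.2 v).symm, sum_sub_distrib, sum_sub_distrib,
    sum_comm, sum_comm (s := S)]
  simp

theorem zero_mem_flowPolytope {V ι : Type*} [Fintype ι] [DecidableEq V] (src tgt : ι → V) :
    (0 : ι → ℝ) ∈ flowPolytope src tgt 0 := by
  simp [flowPolytope]

theorem add_mem_flowPolytope {V ι : Type*} [Fintype ι] [DecidableEq V] {src tgt : ι → V}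
    {a b : V → ℝ} {f g : ι → ℝ} (hf : f ∈ flowPolytope src tgt a)
    (hg : g ∈ flowPolytope src tgt b) : f + g ∈ flowPolytope src tgt (a + b) := by
  refine ⟨fun e => add_nonneg (hf.1 e) (hg.1 e), fun v => ?_⟩
  rw [Pi.add_apply, ← hf.2 v, ← hg.2 v]
  simp only [Pi.add_apply, ← sum_sub_distrib, ← sum_add_distrib]
  exact sum_congr rfl fun e _ => by split_ifs <;> ring

theorem smul_mem_flowPolytope {V ι : Type*} [Fintype ι] [DecidableEq V] {src tgt : ι → V}
    {a : V → ℝ} {f : ι → ℝ} {c : ℝ} (hc : 0 ≤ c) (hf : f ∈ flowPolytope src tgt a) :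
    c • f ∈ flowPolytope src tgt (c • a) := by
  refine ⟨fun e => mul_nonneg hc (hf.1 e), fun v => ?_⟩
  rw [Pi.smul_apply, ← hf.2 v]
  simp [mul_sub, mul_sum]

theorem single_mem_flowPolytope {V ι : Type*} [Fintype ι] [DecidableEq V] [DecidableEq ι]
    (src tgt : ι → V) (e : ι) :
    Pi.single e 1 ∈ flowPolytope src tgt (Pi.single (src e) 1 - Pi.single (tgt e) 1) := by
  refine ⟨fun e' => by rw [Pi.single_apply]; split_ifs <;> norm_num, fun v => ?_⟩
  have key : ∀ g : ι → V, (∑ e', if g e' = v then (Pi.single e 1 : ι → ℝ) e' else 0) =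
      (Pi.single (g e) 1 : V → ℝ) v := fun g => by
    rw [sum_eq_single e (fun e' _ h => by simp [h]) (by simp)]
    simp [Pi.single_apply, eq_comm]
  simp only [key, Pi.sub_apply]

/-- A unit of flow can be sent along any directed path. -/
theorem flowPolytope_nonempty_of_reflTransGen {V ι : Type*} [Fintype ι] [DecidableEq V]
    {src tgt : ι → V} {i j : V}
    (h : Relation.ReflTransGen (fun u v => ∃ e, src e = u ∧ tgt e = v) i j) :
    (flowPolytope src tgt (Pi.single i 1 - Pi.single j 1)).Nonempty := by
  classical
  induction h with
  | refl => exact ⟨0, by simpa using zero_mem_flowPolytope src tgt⟩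
  | tail _ h ih =>
    obtain ⟨e, rfl, rfl⟩ := h
    obtain ⟨f, hf⟩ := ih
    refine ⟨f + Pi.single e 1, ?_⟩
    simpa using add_mem_flowPolytope hf (single_mem_flowPolytope src tgt e)

/-- If some vertex `j` has negative netflow, then it is reachable from a vertex `i` of positive
netflow such that every tight closed set containing `j` contains `i`. -/
theorem exists_pos_reflTransGen {V ι : Type*} [Fintype V] [DecidableEq V] {src tgt : ι → V}
    {a : V → ℝ} (h0 : ∑ v, a v = 0)
    (hS : ∀ S : Finset V, (∀ e, src e ∈ S → tgt e ∈ S) → ∑ v ∈ S, a v ≤ 0)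
    {j : V} (hj : a j < 0) :
    ∃ i, 0 < a i ∧ Relation.ReflTransGen (fun u v => ∃ e, src e = u ∧ tgt e = v) i j ∧
      ∀ S : Finset V, (∀ e, src e ∈ S → tgt e ∈ S) → ∑ v ∈ S, a v = 0 → j ∈ S → i ∈ S := by
  classical
  obtain ⟨T, hT, hmin⟩ := exists_min_image
    (univ.filter fun S : Finset V => (∀ e, src e ∈ S → tgt e ∈ S) ∧ ∑ v ∈ S, a v = 0 ∧ j ∈ S)
    card ⟨univ, by simp [h0]⟩
  simp only [mem_filter, mem_univ, true_and] at hT hmin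
  obtain ⟨hTc, hT0, hjT⟩ := hT
  have hsub : ∀ S : Finset V, (∀ e, src e ∈ S → tgt e ∈ S) → ∑ v ∈ S, a v = 0 → j ∈ S →
      T ⊆ S := fun S hSc hS0 hjS => by
    have hi : ∀ e, src e ∈ T ∩ S → tgt e ∈ T ∩ S := fun e he => by
      rw [mem_inter] at he ⊢; exact ⟨hTc e he.1, hSc e he.2⟩
    have hu : ∀ e, src e ∈ T ∪ S → tgt e ∈ T ∪ S := fun e he => by
      rw [mem_union] at he ⊢; exact he.imp (hTc e) (hSc e)
    have hsum := sum_union_inter (s₁ := T) (s₂ := S) (f := a)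
    have hcard := hmin (T ∩ S) ⟨hi, by linarith [hS _ hi, hS _ hu], mem_inter.2 ⟨hjT, hjS⟩⟩
    exact inter_eq_left.1 (eq_of_subset_of_card_le inter_subset_left hcard)
  set R := fun v => Relation.ReflTransGen (fun u v => ∃ e, src e = u ∧ tgt e = v) v j
  have hcl : ∀ e, src e ∈ T.filter (fun v => ¬ R v) → tgt e ∈ T.filter (fun v => ¬ R v) :=
    fun e he => by
      rw [mem_filter] at he ⊢
      exact ⟨hTc e he.1, fun h => he.2 (h.head ⟨e, rfl, rfl⟩)⟩
  have hsplit := sum_filter_add_sum_filter_not T R a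
  have hnonneg : 0 ≤ ∑ v ∈ T.filter R, a v := by linarith [hS _ hcl]
  obtain ⟨i, hi, hpos⟩ : ∃ i ∈ T.filter R, 0 < a i := by
    by_contra! hneg
    exact absurd hnonneg (not_le.2 <|
      sum_neg' hneg ⟨j, mem_filter.2 ⟨hjT, Relation.ReflTransGen.refl⟩, hj⟩)
  rw [mem_filter] at hi
  exact ⟨i, hpos, hi.2, fun S hSc hS0 hjS => hsub S hSc hS0 hjS hi.1⟩

/-- Feasibility criterion for flows on an arbitrary finite directed graph (sufficiency). -/
theorem flowPolytope_nonempty_of_closed_sum_nonpos {V ι : Type*} [Fintype V] [Fintype ι]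
    [DecidableEq V] {src tgt : ι → V} {a : V → ℝ} (h0 : ∑ v, a v = 0)
    (hS : ∀ S : Finset V, (∀ e, src e ∈ S → tgt e ∈ S) → ∑ v ∈ S, a v ≤ 0) :
    (flowPolytope src tgt a).Nonempty := by
  classical
  induction hm : (univ.filter fun v => a v ≠ 0).card +
      (univ.filter fun S : Finset V =>
        (∀ e, src e ∈ S → tgt e ∈ S) ∧ ∑ v ∈ S, a v ≠ 0).card
    using Nat.strong_induction_on generalizing a with
  | _ m ih =>
  by_cases hneg : ∃ j, a j < 0
  swap
  · push Not at hneg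
    have : a = 0 := funext fun v =>
      (sum_eq_zero_iff_of_nonneg fun v _ => hneg v).1 h0 v (mem_univ v)
    exact ⟨0, this ▸ zero_mem_flowPolytope src tgt⟩
  obtain ⟨j, hj⟩ := hneg
  obtain ⟨i, hi, hreach, htight⟩ := exists_pos_reflTransGen h0 hS hj
  have hclosed : ∀ S : Finset V, (∀ e, src e ∈ S → tgt e ∈ S) → i ∈ S → j ∈ S := by
    intro S hSc hiS
    refine Relation.ReflTransGen.rec (motive := fun v _ => v ∈ S) hiS ?_ hreach
    rintro _ _ - ⟨e, rfl, rfl⟩ h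
    exact hSc e h
  have hij : i ≠ j := by rintro rfl; linarith
  set 𝒮 := univ.filter fun S : Finset V => (∀ e, src e ∈ S → tgt e ∈ S) ∧ j ∈ S ∧ i ∉ S with h𝒮
  obtain ⟨ε, hε, hεmin⟩ := exists_min_image
    (insert (a i) (insert (-a j) (𝒮.image fun S => -∑ v ∈ S, a v))) id (insert_nonempty _ _)
  simp only [mem_insert, mem_image, id, forall_eq_or_imp, forall_exists_index, and_imp,
    forall_apply_eq_imp_iff₂] at hε hεmin
  obtain ⟨-, -, hε𝒮⟩ := hεmin
  have hε0 : 0 < ε := by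
    rcases hε with rfl | rfl | ⟨S, hmem, rfl⟩
    · exact hi
    · linarith
    · rw [h𝒮, mem_filter] at hmem
      have := lt_of_le_of_ne (hS S hmem.2.1)
        fun h => hmem.2.2.2 (htight S hmem.2.1 h hmem.2.2.1)
      linarith
  set b : V → ℝ := a - ε • (Pi.single i 1 - Pi.single j 1) with hb
  have hbsum : ∀ S : Finset V, ∑ v ∈ S, b v =
      ∑ v ∈ S, a v - ε * ((if i ∈ S then 1 else 0) - (if j ∈ S then 1 else 0)) := fun S => by
    simp [hb, sum_sub_distrib, ← mul_sum]
  have hbne : ∀ v, b v ≠ 0 → a v ≠ 0 := fun v hv hav => by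
    have hvi : v ≠ i := by rintro rfl; linarith
    have hvj : v ≠ j := by rintro rfl; linarith
    simp [hb, hvi, hvj, hav] at hv
  have hbtight : ∀ S : Finset V, (∀ e, src e ∈ S → tgt e ∈ S) → ∑ v ∈ S, b v ≠ 0 →
      ∑ v ∈ S, a v ≠ 0 := fun S hSc hS' hS0 => by
    have : i ∈ S ↔ j ∈ S := ⟨hclosed S hSc, htight S hSc hS0⟩
    simp [hbsum, this, hS0] at hS'
  have hsub₁ : (univ.filter fun v => b v ≠ 0) ⊆ univ.filter fun v => a v ≠ 0 :=
    monotone_filter_right _ fun v _ => hbne v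
  have hsub₂ : (univ.filter fun S : Finset V =>
        (∀ e, src e ∈ S → tgt e ∈ S) ∧ ∑ v ∈ S, b v ≠ 0) ⊆ univ.filter fun S : Finset V =>
        (∀ e, src e ∈ S → tgt e ∈ S) ∧ ∑ v ∈ S, a v ≠ 0 :=
    monotone_filter_right _ fun S _ h => ⟨h.1, hbtight S h.1 h.2⟩
  have hlt : (univ.filter fun v => b v ≠ 0).card + (univ.filter fun S : Finset V =>
        (∀ e, src e ∈ S → tgt e ∈ S) ∧ ∑ v ∈ S, b v ≠ 0).card < m := by
    rw [← hm]
    rcases hε with hε | hε | ⟨S, hmem, hε⟩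
    · refine add_lt_add_of_lt_of_le (card_lt_card ⟨hsub₁, fun h => ?_⟩) (card_le_card hsub₂)
      have := h (mem_filter.2 ⟨mem_univ i, hi.ne'⟩)
      simp [hb, hij, hε] at this
    · refine add_lt_add_of_lt_of_le (card_lt_card ⟨hsub₁, fun h => ?_⟩) (card_le_card hsub₂)
      have := h (mem_filter.2 ⟨mem_univ j, hj.ne⟩)
      simp [hb, hij.symm, hε] at this
    · rw [h𝒮, mem_filter] at hmem
      refine add_lt_add_of_le_of_lt (card_le_card hsub₁) (card_lt_card ⟨hsub₂, fun h => ?_⟩)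
      have := h (mem_filter.2 ⟨mem_univ S, hmem.2.1, by linarith⟩)
      simp [hbsum, hmem.2.2, ← hε] at this
  have hb0 : ∑ v, b v = 0 := by simp [hbsum, h0]
  have hbS : ∀ S : Finset V, (∀ e, src e ∈ S → tgt e ∈ S) → ∑ v ∈ S, b v ≤ 0 := by
    intro S hSc
    have hSa := hS S hSc
    rw [hbsum]
    by_cases hiS : i ∈ S
    · simpa [hiS, hclosed S hSc hiS] using hSa
    · by_cases hjS : j ∈ S
      · have := hε𝒮 S (mem_filter.2 ⟨mem_univ S, hSc, hjS, hiS⟩)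
        simp only [hiS, hjS, if_true, if_false]; linarith
      · simpa [hiS, hjS] using hSa
  obtain ⟨f, hf⟩ := ih _ hlt hb0 hbS rfl
  obtain ⟨g, hg⟩ := flowPolytope_nonempty_of_reflTransGen hreach
  refine ⟨f + ε • g, ?_⟩
  simpa [hb] using add_mem_flowPolytope hf (smul_mem_flowPolytope hε0.le hg)

/-- Lemma: feasibility of flows.  Let `G` be a graph on `[0,n]`
(edges indexed by `ι`, each directed from its smaller to its larger endpoint) and
`α ∈ ℝ^{n+1}`.  The flow polytope `F_G(α)` is nonempty if and only if `∑ α_i = 0` and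
`∑_{i ∈ S} α_i ≤ 0` for every subset `S` of the vertices with `outdeg_G(S) = 0`, i.e.
with no edge of `G` leaving `S`. -/
theorem flow_feasibility (n : ℕ) {ι : Type*} [Fintype ι]
    (src tgt : ι → Fin (n + 1)) (hdir : ∀ e, src e < tgt e) (α : Fin (n + 1) → ℝ) :
    (flowPolytope src tgt α).Nonempty ↔
      (∑ i, α i = 0 ∧
        ∀ S : Finset (Fin (n + 1)), (∀ e, src e ∈ S → tgt e ∈ S) → ∑ i ∈ S, α i ≤ 0) := by
  constructor
  · rintro ⟨f, hf⟩
    refine ⟨by simp [sum_netflow_eq hf], fun S hSc => ?_⟩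
    rw [sum_netflow_eq hf]
    refine sum_nonpos fun e _ => ?_
    have := hf.1 e
    by_cases hs : src e ∈ S
    · simp [hs, hSc e hs]
    · rw [if_neg hs]
      split_ifs <;> linarith
  · rintro ⟨h0, hS⟩
    exact flowPolytope_nonempty_of_closed_sum_nonpos h0 hS
end
end
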